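/- arXiv:1008.4180 — 2 statements merged into one kernel-verified Lean document; each statement's English description precedes it below -/
import Mathlib

section
/- For every ε > 0 and every δ > 0 there exists N₀ such that for all N ≥ N₀, the number of primes p ≤ N for which the following property FAILS is at most δ·π(N): for every integer λ there exist positive integers n₁, …, n₁₆ with n_i ≤ N^{1/2+ε} for all i, such that F_{n₁} + F_{n₂} + … + F_{n₁₆} ≡ λ (mod p). -/
lemma card_sq_le_image_mul {α β : Type*} [DecidableEq α] [DecidableEq β] (s : Finset α) (f : α → β) :
    s.card ^ 2 ≤ (s.image f).card * ((s ×ˢ s).filter (fun x => f x.1 = f x.2)).card := by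
  have h1 : s.card = ∑ b ∈ s.image f, (s.filter (fun a => f a = b)).card :=
    Finset.card_eq_sum_card_image f s
  have h2 : ((s ×ˢ s).filter (fun x => f x.1 = f x.2)).card
      = ∑ b ∈ s.image f, (s.filter (fun a => f a = b)).card ^ 2 := by
    rw [Finset.card_eq_sum_card_fiberwise (f := fun x => f x.1) (t := s.image f)]
    · refine Finset.sum_congr rfl fun b _ => ?_
      rw [sq, ← Finset.card_product]
      congr 1
      ext ⟨x, y⟩
      simp only [Finset.mem_filter, Finset.mem_product]
      constructor
      · rintro ⟨⟨⟨hx, hy⟩, h⟩, hb⟩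
        exact ⟨⟨hx, hb⟩, hy, h ▸ hb⟩
      · rintro ⟨⟨hx, hb⟩, hy, hb'⟩
        exact ⟨⟨⟨hx, hy⟩, hb.trans hb'.symm⟩, hb⟩
    · intro x hx
      simp only [Finset.coe_filter, Finset.mem_product, Set.mem_ofPred_eq] at hx
      exact Finset.mem_coe.2 (Finset.mem_image_of_mem _ hx.1.1)
  rw [h2]
  conv_lhs => rw [h1]
  exact sq_sum_le_card_mul_sum_sq

/-- the energy of `A + ξ B` -/
def enSet {p : ℕ} (A B : Finset (ZMod p)) (ξ : ZMod p) :
    Finset ((ZMod p × ZMod p) × (ZMod p × ZMod p)) :=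
  ((A ×ˢ B) ×ˢ (A ×ˢ B)).filter (fun x => x.1.1 + ξ * x.1.2 = x.2.1 + ξ * x.2.2)

lemma en_neg {p : ℕ} (A B : Finset (ZMod p)) (ξ : ZMod p) :
    (enSet A B (-ξ)).card = (enSet A B ξ).card := by
  refine Finset.card_bij' (fun x _ => ((x.1.1, x.2.2), (x.2.1, x.1.2)))
    (fun x _ => ((x.1.1, x.2.2), (x.2.1, x.1.2))) ?_ ?_ ?_ ?_
  · rintro ⟨⟨a, b⟩, ⟨a', b'⟩⟩ h
    simp only [enSet, Finset.mem_filter, Finset.mem_product] at h ⊢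
    refine ⟨⟨⟨h.1.1.1, h.1.2.2⟩, h.1.2.1, h.1.1.2⟩, ?_⟩
    linear_combination h.2
  · rintro ⟨⟨a, b⟩, ⟨a', b'⟩⟩ h
    simp only [enSet, Finset.mem_filter, Finset.mem_product] at h ⊢
    refine ⟨⟨⟨h.1.1.1, h.1.2.2⟩, h.1.2.1, h.1.1.2⟩, ?_⟩
    linear_combination h.2
  · intros; rfl
  · intros; rfl

lemma en_exists {p : ℕ} [Fact p.Prime] (A B : Finset (ZMod p)) :
    ∃ ξ : ZMod p, ξ ≠ 0 ∧ (p - 1) * (enSet A B ξ).card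
      ≤ (A.card * B.card) * (p - 1) + (A.card * B.card) ^ 2 := by
  classical
  have hp : p.Prime := Fact.out
  set U : Finset (ZMod p) := Finset.univ.erase 0 with hU
  have hUc : U.card = p - 1 := by
    rw [hU, Finset.card_erase_of_mem (Finset.mem_univ _), Finset.card_univ, ZMod.card]
  set Q := (A ×ˢ B) ×ˢ (A ×ˢ B) with hQ
  have hsum : ∑ ξ ∈ U, (enSet A B ξ).card
      ≤ (A.card * B.card) * (p - 1) + (A.card * B.card) ^ 2 := by
    have e1 : ∑ ξ ∈ U, (enSet A B ξ).card
        = ∑ x ∈ Q, (U.filter (fun ξ => x.1.1 + ξ * x.1.2 = x.2.1 + ξ * x.2.2)).card := by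
      simp only [enSet, Finset.card_filter]
      exact Finset.sum_comm
    rw [e1]
    have e2 : ∀ x ∈ Q, (U.filter (fun ξ => x.1.1 + ξ * x.1.2 = x.2.1 + ξ * x.2.2)).card
        ≤ (if x.1 = x.2 then (p - 1) else 0) + 1 := by
      rintro ⟨⟨a, b⟩, ⟨a', b'⟩⟩ _
      by_cases h : ((a, b) : ZMod p × ZMod p) = (a', b')
      · simp only [h, if_true]
        calc _ ≤ U.card := Finset.card_filter_le _ _
          _ ≤ _ := by omega
      · simp only [h, if_false, zero_add]
        rw [Finset.card_le_one]
        intro x hx y hy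
        simp only [Finset.mem_filter] at hx hy
        have hbb : b ≠ b' := by
          rintro rfl
          apply h
          have := hx.2
          simp at this
          simp [this]
        have : (x - y) * (b - b') = 0 := by linear_combination hx.2 - hy.2
        rcases mul_eq_zero.1 this with h1 | h1
        · exact sub_eq_zero.1 h1
        · exact absurd (sub_eq_zero.1 h1) hbb
    calc _ ≤ ∑ x ∈ Q, ((if x.1 = x.2 then (p - 1) else 0) + 1) := Finset.sum_le_sum e2
      _ = (Q.filter (fun x => x.1 = x.2)).card * (p - 1) + Q.card := by
        rw [Finset.sum_add_distrib, ← Finset.sum_filter]; simp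
      _ = _ := by
        have : (Q.filter (fun x => x.1 = x.2)).card = A.card * B.card := by
          rw [← Finset.card_product]
          refine Finset.card_bij' (fun x _ => x.1) (fun x _ => (x, x)) ?_ ?_ ?_ ?_
          · intro x hx
            simp only [hQ, Finset.mem_filter, Finset.mem_product] at hx
            simp only [Finset.mem_product]; exact hx.1.1
          · intro x hx
            simp only [hQ, Finset.mem_filter, Finset.mem_product] at hx ⊢
            exact ⟨⟨hx, hx⟩, trivial⟩
          · rintro ⟨x, y⟩ hx
            simp only [Finset.mem_filter] at hx
            simp [hx.2]
          · intros; rfl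
        rw [this, hQ, Finset.card_product, Finset.card_product, sq]
  by_contra! hcon
  have : ∑ ξ ∈ U, ((A.card * B.card) * (p - 1) + (A.card * B.card) ^ 2)
      < ∑ ξ ∈ U, (p - 1) * (enSet A B ξ).card := by
    apply Finset.sum_lt_sum_of_nonempty
    · rw [← Finset.card_pos, hUc]; have := hp.two_le; omega
    · intro ξ hξ
      exact hcon ξ (Finset.ne_of_mem_erase hξ)
  rw [← Finset.mul_sum, Finset.sum_const, hUc, smul_eq_mul] at this
  exact absurd (Nat.mul_le_mul_left (p-1) hsum) (not_le.2 this)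

lemma large_meet {p : ℕ} [Fact p.Prime] (S : Finset (ZMod p)) (hS : p < 2 * S.card) (lam : ZMod p) :
    ∃ x ∈ S, ∃ y ∈ S, x + y = lam := by
  classical
  by_contra! hcon
  have hd : Disjoint S (S.image (fun y => lam - y)) := by
    rw [Finset.disjoint_left]
    intro x hx hx'
    obtain ⟨y, hy, rfl⟩ := Finset.mem_image.1 hx'
    exact hcon _ hx y hy (by ring)
  have h1 := Finset.card_union_of_disjoint hd
  rw [Finset.card_image_of_injective _ (fun a b h => by simpa using h)] at h1
  have h2 := Finset.card_le_univ (S ∪ (S.image (fun y => lam - y)))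
  rw [ZMod.card] at h2
  omega

lemma glib {p : ℕ} [Fact p.Prime] (hp3 : 3 ≤ p) (A B : Finset (ZMod p))
    (h : 4 * p ≤ A.card * B.card)
    (hB : ∀ b₁ ∈ B, ∀ b₂ ∈ B, b₁ + b₂ ≠ 0) (lam : ZMod p) :
    ∃ a b : Fin 8 → ZMod p, (∀ i, a i ∈ A ∧ b i ∈ B) ∧ ∑ i, b i * a i = lam := by
  classical
  obtain ⟨ξ, hξ, hE⟩ := en_exists A B
  have hbig : ∀ ζ : ZMod p, (enSet A B ζ).card = (enSet A B ξ).card →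
      p < 2 * ((A ×ˢ B).image (fun x => x.1 + ζ * x.2)).card := by
    intro ζ hζ
    have h1 := card_sq_le_image_mul (A ×ˢ B) (fun x => x.1 + ζ * x.2)
    have h2 : (((A ×ˢ B) ×ˢ (A ×ˢ B)).filter
      (fun x => x.1.1 + ζ * x.1.2 = x.2.1 + ζ * x.2.2)).card = (enSet A B ζ).card := rfl
    rw [h2, hζ, Finset.card_product] at h1
    set M := A.card * B.card
    set E := (enSet A B ξ).card
    set s := ((A ×ˢ B).image (fun x => x.1 + ζ * x.2)).card
    by_contra! hs
    obtain ⟨r, rfl⟩ : ∃ r, p = r + 3 := ⟨p - 3, by omega⟩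
    simp only [show r + 3 - 1 = r + 2 by omega] at hE
    have h3 : 2 * M ^ 2 ≤ (r + 3) * E := by nlinarith
    have h4 : 2 * M ^ 2 * (r + 2) ≤ (r + 3) * (M * (r + 2) + M ^ 2) := by
      calc 2 * M ^ 2 * (r + 2) ≤ (r + 3) * E * (r + 2) := Nat.mul_le_mul_right _ h3
        _ = (r + 3) * ((r + 2) * E) := by ring
        _ ≤ _ := Nat.mul_le_mul_left _ hE
    have hM : 0 < M := by omega
    have h5 : M * (r + 1) ≤ (r + 3) * (r + 2) := by
      by_contra! hc
      have : M * ((r + 3) * (r + 2)) < M * (M * (r + 1)) := Nat.mul_lt_mul_of_pos_left hc hM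
      nlinarith
    nlinarith
  have hm := hbig (-ξ) (en_neg A B ξ)
  have hp := hbig ξ rfl
  obtain ⟨x, hx, y, hy, hxy⟩ := large_meet _ hm 0
  obtain ⟨⟨a₁, b₁⟩, hab1, rfl⟩ := Finset.mem_image.1 hx
  obtain ⟨⟨a₂, b₂⟩, hab2, rfl⟩ := Finset.mem_image.1 hy
  simp only [Finset.mem_product] at hab1 hab2
  have hb := hB b₁ hab1.2 b₂ hab2.2
  have hxi : ξ * (b₁ + b₂) = a₁ + a₂ := by simp only at hxy; linear_combination -hxy
  obtain ⟨x, hx, y, hy, hxy'⟩ := large_meet _ hp (lam / (b₁ + b₂))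
  obtain ⟨⟨a, b⟩, hab, rfl⟩ := Finset.mem_image.1 hx
  obtain ⟨⟨a', b'⟩, hab', rfl⟩ := Finset.mem_image.1 hy
  simp only [Finset.mem_product] at hab hab'
  refine ⟨![a, a, a₁, a₂, a', a', a₁, a₂], ![b₁, b₂, b, b, b₁, b₂, b', b'], ?_, ?_⟩
  · intro i
    fin_cases i <;> simp [hab1, hab2, hab, hab']
  · rw [eq_div_iff hb] at hxy'
    simp only at hxy'
    simp [Fin.sum_univ_eight]
    linear_combination hxy' - (b + b') * hxi

/-- Fibonacci numbers as integers -/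
def fz (n : ℕ) : ℤ := (Nat.fib n : ℤ)
/-- Lucas numbers as integers -/
def lz (n : ℕ) : ℤ := 2 * fz (n + 1) - fz n

lemma fz_rec (n : ℕ) : fz (n + 2) = fz n + fz (n + 1) := by
  simp [fz, Nat.fib_add_two]

lemma lz_rec (n : ℕ) : lz (n + 2) = lz n + lz (n + 1) := by
  have h1 := fz_rec n
  have h2 := fz_rec (n + 1)
  simp only [lz]
  linarith

lemma fz_add (m n : ℕ) : fz (m + n + 1) = fz m * fz n + fz (m + 1) * fz (n + 1) := by
  simp [fz, Nat.fib_add]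

lemma cassini (m : ℕ) : fz (m + 1) ^ 2 - fz (m + 1) * fz m - fz m ^ 2 = (-1) ^ m := by
  induction m with
  | zero => simp [fz]
  | succ m ih =>
    rw [fz_rec, pow_succ (-1 : ℤ) m, ← ih]; ring

lemma two_step (f : ℕ → ℤ) (hf : ∀ n, f (n + 2) = f n + f (n + 1)) (h0 : f 0 = 0) (h1 : f 1 = 0) :
    ∀ n, f n = 0 := by
  intro n
  have : f n = 0 ∧ f (n + 1) = 0 := by
    induction n with
    | zero => exact ⟨h0, h1⟩
    | succ n ih => exact ⟨ih.2, by rw [hf, ih.1, ih.2]; rfl⟩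
  exact this.1

lemma fz_double (y : ℕ) : fz (2 * y) = fz y * lz y := by
  rcases y with _ | y
  · simp [fz]
  · have := fz_add y (y + 1)
    rw [show 2 * (y + 1) = y + (y + 1) + 1 by ring, this, lz, fz_rec]
    have := fz_rec y
    ring

lemma fz_double1 (y : ℕ) : fz (2 * y + 1) = fz y ^ 2 + fz (y + 1) ^ 2 := by
  rw [show 2 * y + 1 = y + y + 1 by ring, fz_add]; ring

lemma fz_sub (y k : ℕ) (hy : Even y) : fz (2 * y + k) - fz k = fz y * lz (y + k) := by
  have hc := cassini y
  rw [hy.neg_one_pow] at hc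
  have := two_step (fun k => fz (2 * y + k) - fz k - fz y * lz (y + k)) ?_ ?_ ?_ k
  · linarith
  · intro n
    simp only [← add_assoc, fz_rec, lz_rec]
    ring
  · simp only [add_zero, fz_double]; simp [fz]
  · simp only [fz_double1, lz, fz_rec]
    simp only [fz] at *
    simp only [Nat.fib_one]
    push_cast
    linear_combination hc

lemma fz_sum (y k : ℕ) (hy : Even y) : fz (2 * y + k) + fz k = lz y * fz (y + k) := by
  have hc := cassini y
  rw [hy.neg_one_pow] at hc
  have := two_step (fun k => fz (2 * y + k) + fz k - lz y * fz (y + k)) ?_ ?_ ?_ k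
  · linarith
  · intro n
    simp only [← add_assoc, fz_rec]
    ring
  · simp only [add_zero, fz_double]; simp [fz]; ring
  · simp only [fz_double1, lz]
    simp only [fz] at *
    simp only [Nat.fib_one]
    push_cast
    linear_combination -hc

lemma lz_sub (y k : ℕ) (hy : Even y) : lz (2 * y + k) - lz k = 5 * fz y * fz (y + k) := by
  have h1 := fz_sub y (k + 1) hy
  have h2 := fz_sub y k hy
  simp only [← add_assoc] at h1
  simp only [lz, fz_rec] at *
  linear_combination 2 * h1 - h2

lemma lz_sum (y k : ℕ) (hy : Even y) : lz (2 * y + k) + lz k = lz y * lz (y + k) := by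
  have h1 := fz_sum y (k + 1) hy
  have h2 := fz_sum y k hy
  simp only [← add_assoc] at h1
  simp only [lz] at *
  linear_combination 2 * h1 - h2

lemma dvd_fz_iff (p n : ℕ) : (p : ℤ) ∣ fz n ↔ p ∣ Nat.fib n := by
  rw [fz]; exact Int.natCast_dvd_natCast

lemma dvd_double_of_dvd_lz (p n : ℕ) (h : (p : ℤ) ∣ lz n) : p ∣ Nat.fib (2 * n) := by
  rw [← dvd_fz_iff, fz_double]; exact h.mul_left _

/-- Frobenius: `p` divides `F_{p-1}` or `F_{p+1}`. -/
lemma fib_sq_eq_one (p : ℕ) [Fact p.Prime] (h5 : p ≠ 5) : ((Nat.fib p : ZMod p)) ^ 2 = 1 := by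
  have hp : p.Prime := Fact.out
  let K := AlgebraicClosure (ZMod p)
  have : CharP K p := charP_of_injective_algebraMap (algebraMap (ZMod p) K).injective p
  obtain ⟨α, hα⟩ : ∃ α : K, α ^ 2 = α + 1 := by
    have hdeg : (Polynomial.X ^ 2 - Polynomial.X - 1 : Polynomial K).degree ≠ 0 := by
      have : (Polynomial.X ^ 2 - Polynomial.X - 1 : Polynomial K).degree = 2 := by
        compute_degree!
      rw [this]; decide
    obtain ⟨α, h⟩ := IsAlgClosed.exists_root _ hdeg
    refine ⟨α, ?_⟩
    simp [Polynomial.IsRoot] at h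
    linear_combination h
  set β : K := 1 - α with hβ
  have hβ2 : β ^ 2 = β + 1 := by rw [hβ]; linear_combination hα
  have hF : ∀ n : ℕ, (Nat.fib n : K) * (α - β) = α ^ n - β ^ n ∧
      (Nat.fib (n + 1) : K) * (α - β) = α ^ (n + 1) - β ^ (n + 1) := by
    intro n
    induction n with
    | zero => simp
    | succ n ih =>
      refine ⟨ih.2, ?_⟩
      rw [Nat.fib_add_two]
      push_cast
      linear_combination ih.1 + ih.2 - α ^ n * hα + β ^ n * hβ2
  have h1 : (α - β) ^ p = (Nat.fib p : K) * (α - β) := by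
    rw [(hF p).1, sub_pow_char]
  have h2 : (α - β) ^ 2 = 5 := by rw [hβ]; linear_combination 4 * hα
  have h5K : (5 : K) ^ p = 5 := by
    have := ZMod.pow_card (p := p) (5 : ZMod p)
    have h := congrArg (algebraMap (ZMod p) K) this
    rw [map_pow, map_ofNat] at h
    exact h
  have h50 : (5 : K) ≠ 0 := by
    intro h
    have : ((5 : ℕ) : K) = 0 := by exact_mod_cast h
    rw [CharP.cast_eq_zero_iff K p] at this
    exact h5 ((Nat.prime_dvd_prime_iff_eq hp Nat.prime_five).1 this)
  have h3 : (Nat.fib p : K) ^ 2 * 5 = 1 * 5 := by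
    calc (Nat.fib p : K) ^ 2 * 5 = ((Nat.fib p : K) * (α - β)) ^ 2 := by rw [mul_pow, h2]
      _ = ((α - β) ^ 2) ^ p := by rw [← h1, ← pow_mul, ← pow_mul, mul_comm]
      _ = 1 * 5 := by rw [h2, h5K, one_mul]
  have h4 := mul_right_cancel₀ h50 h3
  apply (algebraMap (ZMod p) K).injective
  simpa using h4

lemma dvd_fib_pm (p : ℕ) (hp : p.Prime) (h2 : p ≠ 2) (h5 : p ≠ 5) :
    p ∣ Nat.fib (p - 1) ∨ p ∣ Nat.fib (p + 1) := by
  have := Fact.mk hp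
  have h := fib_sq_eq_one p h5
  have hodd : Odd p := hp.odd_of_ne_two h2
  obtain ⟨r, hr⟩ : ∃ r, p = r + 1 := ⟨p - 1, by have := hp.pos; omega⟩
  have hev : Even r := by rw [hr] at hodd; by_contra hc; exact (Nat.not_odd_iff_even.2 ((Nat.not_even_iff_odd.1 hc).add_one)) hodd
  have hc := cassini r
  rw [hev.neg_one_pow] at hc
  have h1 : ((p : ℤ)) ∣ fz p ^ 2 - 1 := by
    rw [← ZMod.intCast_zmod_eq_zero_iff_dvd]
    simp only [fz]
    push_cast
    rw [h, sub_self]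
  have h3 : fz p ^ 2 - 1 = fz r * fz (r + 2) := by
    rw [fz_rec, hr]; linear_combination hc
  rw [h3] at h1
  rcases (Nat.prime_iff_prime_int.1 hp).dvd_or_dvd h1 with h | h
  · left; rw [dvd_fz_iff] at h; rw [hr] at h ⊢; exact h
  · right; rw [dvd_fz_iff] at h; rw [hr] at h ⊢; exact h

/-- If `p` divides some `F_k` with `1 ≤ k ≤ H`, the rank of apparition has the same property and
divides `p - 1` or `p + 1`. -/
lemma rank_exists (p : ℕ) (hp : p.Prime) (h2 : p ≠ 2) (h5 : p ≠ 5) (H : ℕ)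
    (h : ∃ k, 1 ≤ k ∧ k ≤ H ∧ p ∣ Nat.fib k) :
    ∃ z m, 1 ≤ z ∧ z ≤ H ∧ p ∣ Nat.fib z ∧ (p = z * m + 1 ∨ p + 1 = z * m) := by
  classical
  have hex : ∃ k, 1 ≤ k ∧ p ∣ Nat.fib k := by
    obtain ⟨k, h1, _, h3⟩ := h; exact ⟨k, h1, h3⟩
  obtain ⟨k, hk1, hkH, hk⟩ := h
  have hz := Nat.find_spec hex
  set z := Nat.find hex with hzdef
  have hzk : z ≤ k := Nat.find_min' hex ⟨hk1, hk⟩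
  have hdiv : ∀ n, p ∣ Nat.fib n → z ∣ n := by
    intro n hn
    have hg : p ∣ Nat.fib (Nat.gcd z n) := by
      rw [Nat.fib_gcd]; exact Nat.dvd_gcd hz.2 hn
    have hpos : 1 ≤ Nat.gcd z n := Nat.gcd_pos_of_pos_left _ hz.1
    have := Nat.find_min' hex ⟨hpos, hg⟩
    have h' := Nat.le_of_dvd hz.1 (Nat.gcd_dvd_left z n)
    have : Nat.gcd z n = z := le_antisymm h' this
    rw [← this]; exact Nat.gcd_dvd_right _ _
  rcases dvd_fib_pm p hp h2 h5 with h | h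
  · obtain ⟨m, hm⟩ := hdiv _ h
    exact ⟨z, m, hz.1, hzk.trans hkH, hz.2, Or.inl (by have := hp.pos; omega)⟩
  · obtain ⟨m, hm⟩ := hdiv _ h
    exact ⟨z, m, hz.1, hzk.trans hkH, hz.2, Or.inr hm⟩

lemma fib_inj_aux (p H : ℕ) (hz : ∀ k, 1 ≤ k → k ≤ 16 * H → ¬ p ∣ Nat.fib k) (hp : p.Prime)
    (i j : ℕ) (hij : i < j) (hj : j ≤ 2 * H) : ¬ (p : ℤ) ∣ fz (4 * j) - fz (4 * i) := by
  intro h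
  have := fz_sub (2 * (j - i)) (4 * i) (even_two_mul _)
  rw [show 2 * (2 * (j - i)) + 4 * i = 4 * j by omega] at this
  rw [this] at h
  rcases (Nat.prime_iff_prime_int.1 hp).dvd_or_dvd h with h | h
  · exact hz _ (by omega) (by omega) ((dvd_fz_iff _ _).1 h)
  · exact hz _ (by omega) (by omega) (dvd_double_of_dvd_lz _ _ h)

lemma luc_inj_aux (p H : ℕ) (hz : ∀ k, 1 ≤ k → k ≤ 16 * H → ¬ p ∣ Nat.fib k) (hp : p.Prime)
    (h5 : p ≠ 5) (i j : ℕ) (hij : i < j) (hj : j ≤ H) : ¬ (p : ℤ) ∣ lz (4 * j) - lz (4 * i) := by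
  intro h
  have := lz_sub (2 * (j - i)) (4 * i) (even_two_mul _)
  rw [show 2 * (2 * (j - i)) + 4 * i = 4 * j by omega] at this
  rw [this] at h
  rcases (Nat.prime_iff_prime_int.1 hp).dvd_or_dvd h with h | h
  · rcases (Nat.prime_iff_prime_int.1 hp).dvd_or_dvd h with h | h
    · have : p ∣ 5 := by exact_mod_cast h
      exact h5 ((Nat.prime_dvd_prime_iff_eq hp Nat.prime_five).1 this)
    · exact hz _ (by omega) (by omega) ((dvd_fz_iff _ _).1 h)
  · exact hz _ (by omega) (by omega) ((dvd_fz_iff _ _).1 h)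

lemma luc_anti_aux (p H : ℕ) (hz : ∀ k, 1 ≤ k → k ≤ 16 * H → ¬ p ∣ Nat.fib k) (hp : p.Prime)
    (h2 : p ≠ 2) (i j : ℕ) (hi : 1 ≤ i) (hij : i ≤ j) (hj : j ≤ H) :
    ¬ (p : ℤ) ∣ lz (4 * j) + lz (4 * i) := by
  intro h
  have := lz_sum (2 * (j - i)) (4 * i) (even_two_mul _)
  rw [show 2 * (2 * (j - i)) + 4 * i = 4 * j by omega] at this
  rw [this] at h
  rcases (Nat.prime_iff_prime_int.1 hp).dvd_or_dvd h with h | h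
  · rcases hij.eq_or_lt with rfl | hlt
    · simp [lz, fz] at h
      have : p ∣ 2 := by exact_mod_cast h
      exact h2 ((Nat.prime_dvd_prime_iff_eq hp Nat.prime_two).1 this)
    · exact hz _ (by omega) (by omega) (dvd_double_of_dvd_lz _ _ h)
  · exact hz _ (by omega) (by omega) (dvd_double_of_dvd_lz _ _ h)

/-- Concatenating two 8-tuples. -/
theorem concat_fin (s t : Fin 8 → ℕ) (P : ℕ → Prop) (hs : ∀ i, P (s i)) (ht : ∀ i, P (t i))
    (f : ℕ → ℤ) : ∃ n : Fin 16 → ℕ, (∀ i, P (n i)) ∧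
      (∑ i, f (n i)) = ∑ j, (f (s j) + f (t j)) := by
  have h : ∃ n : Fin (8 + 8) → ℕ, (∀ i, P (n i)) ∧
      (∑ i, f (n i)) = ∑ j, (f (s j) + f (t j)) := by
    refine ⟨Fin.append s t, ?_, ?_⟩
    · intro i
      refine Fin.addCases (fun j => ?_) (fun j => ?_) i
      · rw [Fin.append_left]; exact hs j
      · rw [Fin.append_right]; exact ht j
    · rw [Fin.sum_univ_add, Finset.sum_add_distrib]
      simp only [Fin.append_left, Fin.append_right]
  exact h

/-- If the rank of apparition of `p` is large, sums of 16 Fibonacci numbers cover everything. -/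
theorem large_rank (p H : ℕ) (hp : p.Prime) (h2 : p ≠ 2) (h5 : p ≠ 5)
    (hz : ∀ k, 1 ≤ k → k ≤ 16 * H → ¬ p ∣ Nat.fib k) (hH : 4 * p ≤ H * H) (lam : ℤ) :
    ∃ n : Fin 16 → ℕ, (∀ i, 1 ≤ n i ∧ n i ≤ 12 * H) ∧
      (∑ i, (Nat.fib (n i) : ℤ)) ≡ lam [ZMOD p] := by
  classical
  have := Fact.mk hp
  have hp3 : 3 ≤ p := by have := hp.two_le; omega
  set A : Finset (ZMod p) := (Finset.Ioc H (2 * H)).image (fun i => ((fz (4 * i) : ℤ) : ZMod p))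
  set B : Finset (ZMod p) := (Finset.Icc 1 H).image (fun i => ((lz (4 * i) : ℤ) : ZMod p))
  have hA : A.card = H := by
    rw [Finset.card_image_of_injOn]
    · simp; omega
    · intro i hi j hj hij
      simp only [Finset.coe_Ioc, Set.mem_Ioc] at hi hj
      simp only at hij
      by_contra hne
      rcases lt_or_gt_of_ne hne with h | h
      · exact fib_inj_aux p H hz hp i j h hj.2
          ((ZMod.intCast_zmod_eq_zero_iff_dvd _ _).1 (by push_cast; rw [hij, sub_self]))
      · exact fib_inj_aux p H hz hp j i h hi.2
          ((ZMod.intCast_zmod_eq_zero_iff_dvd _ _).1 (by push_cast; rw [hij, sub_self]))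
  have hB : B.card = H := by
    rw [Finset.card_image_of_injOn]
    · simp
    · intro i hi j hj hij
      simp only [Finset.coe_Icc, Set.mem_Icc] at hi hj
      simp only at hij
      by_contra hne
      rcases lt_or_gt_of_ne hne with h | h
      · exact luc_inj_aux p H hz hp h5 i j h hj.2
          ((ZMod.intCast_zmod_eq_zero_iff_dvd _ _).1 (by push_cast; rw [hij, sub_self]))
      · exact luc_inj_aux p H hz hp h5 j i h hi.2
          ((ZMod.intCast_zmod_eq_zero_iff_dvd _ _).1 (by push_cast; rw [hij, sub_self]))
  have hanti : ∀ b₁ ∈ B, ∀ b₂ ∈ B, b₁ + b₂ ≠ 0 := by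
    intro b₁ hb₁ b₂ hb₂ h0
    obtain ⟨i, hi, rfl⟩ := Finset.mem_image.1 hb₁
    obtain ⟨j, hj, rfl⟩ := Finset.mem_image.1 hb₂
    simp only [Finset.mem_Icc] at hi hj
    rcases le_total i j with h | h
    · exact luc_anti_aux p H hz hp h2 i j hi.1 h hj.2
        ((ZMod.intCast_zmod_eq_zero_iff_dvd _ _).1 (by push_cast; rw [add_comm]; exact h0))
    · exact luc_anti_aux p H hz hp h2 j i hj.1 h hi.2
        ((ZMod.intCast_zmod_eq_zero_iff_dvd _ _).1 (by push_cast; exact h0))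
  obtain ⟨a, b, hab, hsum⟩ := glib hp3 A B (by rw [hA, hB]; exact hH) hanti (lam : ZMod p)
  have h1 : ∀ i, ∃ u, (H < u ∧ u ≤ 2 * H) ∧ ((fz (4 * u) : ℤ) : ZMod p) = a i := by
    intro i
    obtain ⟨u, hu, h⟩ := Finset.mem_image.1 (hab i).1
    exact ⟨u, Finset.mem_Ioc.1 hu, h⟩
  have h1' : ∀ i, ∃ u, (1 ≤ u ∧ u ≤ H) ∧ ((lz (4 * u) : ℤ) : ZMod p) = b i := by
    intro i
    obtain ⟨u, hu, h⟩ := Finset.mem_image.1 (hab i).2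
    exact ⟨u, Finset.mem_Icc.1 hu, h⟩
  choose u hu hua using h1
  choose v hv hvb using h1'
  obtain ⟨n, hn, hs⟩ := concat_fin (fun j => 4 * u j + 4 * v j) (fun j => 4 * u j - 4 * v j)
    (fun x => 1 ≤ x ∧ x ≤ 12 * H)
    (fun j => by have := hu j; have := hv j; omega)
    (fun j => by have := hu j; have := hv j; omega) (fun x => (Nat.fib x : ℤ))
  refine ⟨n, hn, ?_⟩
  · rw [← ZMod.intCast_eq_intCast_iff, ← hsum, hs, Int.cast_sum]
    refine Finset.sum_congr rfl fun i _ => ?_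
    rw [← hua i, ← hvb i, ← Int.cast_mul]
    congr 1
    have h3 := fz_sum (4 * v i) (4 * u i - 4 * v i) (by
      rw [show 4 * v i = 2 * (2 * v i) by ring]; exact even_two_mul _)
    have := hu i; have := hv i
    rw [show 2 * (4 * v i) + (4 * u i - 4 * v i) = 4 * u i + 4 * v i by omega,
      show 4 * v i + (4 * u i - 4 * v i) = 4 * u i by omega] at h3
    exact h3

/-! ### Selberg sieve -/

open ArithmeticFunction in
theorem mu_interval (m n : ℕ) (hn : Squarefree n) (hmn : m ∣ n) :
    ∑ d ∈ n.divisors with m ∣ d, moebius d = if m = n then moebius m else 0 := by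
  obtain ⟨c, rfl⟩ := hmn
  have hn0 : m * c ≠ 0 := hn.ne_zero
  have hm0 : m ≠ 0 := left_ne_zero_of_mul hn0
  have hc0 : c ≠ 0 := right_ne_zero_of_mul hn0
  have h1 : ((m * c).divisors.filter (fun d => m ∣ d)) = c.divisors.image (fun x => m * x) := by
    ext d
    simp only [Finset.mem_filter, Nat.mem_divisors, Finset.mem_image]
    constructor
    · rintro ⟨⟨h1, _⟩, x, rfl⟩
      exact ⟨x, ⟨Nat.dvd_of_mul_dvd_mul_left (Nat.pos_of_ne_zero hm0) h1, hc0⟩, rfl⟩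
    · rintro ⟨x, ⟨h1, _⟩, rfl⟩
      exact ⟨⟨Nat.mul_dvd_mul_left m h1, hn0⟩, dvd_mul_right _ _⟩
  rw [h1, Finset.sum_image (fun x _ y _ h => Nat.eq_of_mul_eq_mul_left (Nat.pos_of_ne_zero hm0) h)]
  have h2 : ∀ x ∈ c.divisors, moebius (m * x) = moebius m * moebius x := by
    intro x hx
    apply isMultiplicative_moebius.map_mul_of_coprime
    apply Nat.coprime_of_squarefree_mul
    exact hn.squarefree_of_dvd (Nat.mul_dvd_mul_left m (Nat.dvd_of_mem_divisors hx))
  rw [Finset.sum_congr rfl h2, ← Finset.mul_sum]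
  have h3 : ∑ x ∈ c.divisors, moebius x = if c = 1 then 1 else 0 := by
    rw [← coe_mul_zeta_apply, moebius_mul_coe_zeta, one_apply]
  rw [h3]
  by_cases hc : c = 1
  · simp [hc]
  · rw [if_neg hc, if_neg, mul_zero]
    intro h
    exact hc (Nat.eq_of_mul_eq_mul_left (Nat.pos_of_ne_zero hm0) (by rw [mul_one]; exact h.symm))

/-- The sieving set. -/
def dSet (k D : ℕ) : Finset ℕ := (Finset.Icc 1 D).filter (fun m => Squarefree m ∧ Nat.Coprime m k)

theorem mem_dSet {k D m : ℕ} :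
    m ∈ dSet k D ↔ (1 ≤ m ∧ m ≤ D) ∧ Squarefree m ∧ Nat.Coprime m k := by
  simp [dSet]

theorem dSet_dvd {k D m d : ℕ} (hm : m ∈ dSet k D) (hd : d ∣ m) : d ∈ dSet k D := by
  rw [mem_dSet] at *
  have h0 : 0 < m := hm.1.1
  exact ⟨⟨Nat.pos_of_dvd_of_pos hd h0, (Nat.le_of_dvd h0 hd).trans hm.1.2⟩,
    hm.2.1.squarefree_of_dvd hd, hm.2.2.coprime_dvd_left hd⟩

/-- The Selberg normalising sum. -/
noncomputable def gSum (k D : ℕ) : ℝ := ∑ m ∈ dSet k D, (1 : ℝ) / (Nat.totient m : ℝ)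

/-- The Selberg weights divided by `d`. -/
noncomputable def lamW (k D d : ℕ) : ℝ :=
  (ArithmeticFunction.moebius d : ℝ) / gSum k D *
    ∑ m ∈ dSet k D with d ∣ m, (1 : ℝ) / (Nat.totient m : ℝ)

theorem one_mem_dSet {k D : ℕ} (hD : 1 ≤ D) : 1 ∈ dSet k D := by
  rw [mem_dSet]; simp [hD]

theorem gSum_pos {k D : ℕ} (hD : 1 ≤ D) : 0 < gSum k D := by
  unfold gSum
  apply Finset.sum_pos
  · intro m hm
    have : 0 < Nat.totient m := Nat.totient_pos.2 (mem_dSet.1 hm).1.1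
    positivity
  · exact ⟨1, one_mem_dSet hD⟩

theorem lamW_one {k D : ℕ} (hD : 1 ≤ D) : lamW k D 1 = 1 := by
  have h := gSum_pos (k := k) hD
  unfold lamW
  simp only [one_dvd, Finset.filter_true, ArithmeticFunction.moebius_apply_one]
  rw [← gSum]
  field_simp
  simp

theorem abs_lamW_le {k D : ℕ} (hD : 1 ≤ D) (d : ℕ) : |lamW k D d| ≤ 1 := by
  have h := gSum_pos (k := k) hD
  unfold lamW
  rw [abs_mul, abs_div, abs_of_pos h]
  have h1 : |((ArithmeticFunction.moebius d : ℤ) : ℝ)| ≤ 1 := by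
    exact_mod_cast (ArithmeticFunction.abs_moebius_le_one (n := d))
  have h2 : |∑ m ∈ dSet k D with d ∣ m, (1 : ℝ) / (Nat.totient m : ℝ)| ≤ gSum k D := by
    rw [abs_of_nonneg (Finset.sum_nonneg fun _ _ => by positivity)]
    unfold gSum
    exact Finset.sum_le_sum_of_subset_of_nonneg (Finset.filter_subset _ _)
      (fun _ _ _ => by positivity)
  rw [div_mul_eq_mul_div, div_le_one h]
  calc _ ≤ 1 * gSum k D := mul_le_mul h1 h2 (abs_nonneg _) zero_le_one
    _ = _ := one_mul _

theorem lamW_sum {k D m : ℕ} (hm : m ∈ dSet k D) :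
    ∑ d ∈ dSet k D with m ∣ d, lamW k D d =
      (ArithmeticFunction.moebius m : ℝ) / (gSum k D * Nat.totient m) := by
  have e1 : ∑ d ∈ dSet k D with m ∣ d, lamW k D d =
      ∑ n ∈ dSet k D, (∑ d ∈ n.divisors with m ∣ d, (ArithmeticFunction.moebius d : ℝ)) *
        (1 / gSum k D * (1 / (Nat.totient n : ℝ))) := by
    unfold lamW
    simp_rw [Finset.mul_sum, Finset.sum_mul]
    apply Finset.sum_comm'
      (t' := dSet k D) (s' := fun n => n.divisors.filter (fun d => m ∣ d)) _ |>.trans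
    · refine Finset.sum_congr rfl fun n _ => Finset.sum_congr rfl fun d _ => ?_
      ring
    · intro d n
      simp only [Finset.mem_filter, Nat.mem_divisors]
      constructor
      · rintro ⟨⟨h1, h2⟩, h3, h4⟩
        exact ⟨⟨⟨h4, by have := (mem_dSet.1 h3).1.1; omega⟩, h2⟩, h3⟩
      · rintro ⟨⟨⟨h4, _⟩, h2⟩, h3⟩
        exact ⟨⟨dSet_dvd h3 h4, h2⟩, h3, h4⟩
  rw [e1, Finset.sum_eq_single_of_mem m hm]
  · have := mu_interval m m (mem_dSet.1 hm).2.1 dvd_rfl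
    rw [if_pos rfl] at this
    rw [← Int.cast_sum, this]
    field_simp
  · intro n hn hne
    by_cases hmn : m ∣ n
    · have := mu_interval m n (mem_dSet.1 hn).2.1 hmn
      rw [if_neg (Ne.symm hne)] at this
      rw [← Int.cast_sum, this]
      simp
    · rw [Finset.filter_eq_empty_iff.2, Finset.sum_empty, zero_mul]
      intro d hd hmd
      exact hmn (hmd.trans (Nat.dvd_of_mem_divisors hd))

theorem lamW_quad {k D : ℕ} (hD : 1 ≤ D) :
    ∑ d ∈ dSet k D, ∑ d' ∈ dSet k D, lamW k D d * lamW k D d' * (Nat.gcd d d' : ℝ) =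
      1 / gSum k D := by
  have hg := gSum_pos (k := k) hD
  have e1 : ∀ d ∈ dSet k D, ∀ d' ∈ dSet k D, lamW k D d * lamW k D d' * (Nat.gcd d d' : ℝ) =
      ∑ m ∈ dSet k D, (if m ∣ d then lamW k D d else 0) * (if m ∣ d' then lamW k D d' else 0) *
        (Nat.totient m : ℝ) := by
    intro d hd d' hd'
    have h0 : Nat.gcd d d' ≠ 0 := by
      have := (mem_dSet.1 hd).1.1
      exact (Nat.gcd_pos_of_pos_left _ this).ne'
    have h1 : (Nat.gcd d d' : ℝ) = ∑ m ∈ (Nat.gcd d d').divisors, (Nat.totient m : ℝ) := by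
      rw [← Nat.cast_sum, Nat.sum_totient]
    have h2 : (Nat.gcd d d').divisors = (dSet k D).filter (fun m => m ∣ d ∧ m ∣ d') := by
      ext m
      simp only [Nat.mem_divisors, Finset.mem_filter, Nat.dvd_gcd_iff]
      constructor
      · rintro ⟨h, _⟩; exact ⟨dSet_dvd hd h.1, h⟩
      · rintro ⟨_, h⟩; exact ⟨h, h0⟩
    rw [h1, h2, Finset.mul_sum, Finset.sum_filter]
    refine Finset.sum_congr rfl fun m _ => ?_
    by_cases ha : m ∣ d <;> by_cases hb : m ∣ d' <;> simp [ha, hb]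
  rw [Finset.sum_congr rfl fun d hd => Finset.sum_congr rfl fun d' hd' => e1 d hd d' hd']
  have e2 : ∑ d ∈ dSet k D, ∑ d' ∈ dSet k D, ∑ m ∈ dSet k D,
      (if m ∣ d then lamW k D d else 0) * (if m ∣ d' then lamW k D d' else 0) *
        (Nat.totient m : ℝ) = ∑ m ∈ dSet k D, (Nat.totient m : ℝ) *
        (∑ d ∈ dSet k D with m ∣ d, lamW k D d) ^ 2 := by
    rw [Finset.sum_congr rfl fun d _ => Finset.sum_comm, Finset.sum_comm]
    refine Finset.sum_congr rfl fun m _ => ?_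
    rw [Finset.sum_filter, sq, Finset.sum_mul_sum, Finset.mul_sum]
    refine Finset.sum_congr rfl fun d _ => ?_
    rw [Finset.mul_sum]
    refine Finset.sum_congr rfl fun d' _ => ?_
    ring
  rw [e2]
  have e3 : ∀ m ∈ dSet k D, (Nat.totient m : ℝ) * (∑ d ∈ dSet k D with m ∣ d, lamW k D d) ^ 2 =
      1 / gSum k D ^ 2 * (1 / (Nat.totient m : ℝ)) := by
    intro m hm
    rw [lamW_sum hm, div_pow]
    have h1 : ((ArithmeticFunction.moebius m : ℤ) : ℝ) ^ 2 = 1 := by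
      exact_mod_cast ArithmeticFunction.moebius_sq_eq_one_of_squarefree (mem_dSet.1 hm).2.1
    have h2 : (Nat.totient m : ℝ) ≠ 0 := by
      have : 0 < Nat.totient m := Nat.totient_pos.2 (mem_dSet.1 hm).1.1
      positivity
    rw [h1]
    field_simp
  rw [Finset.sum_congr rfl e3, ← Finset.mul_sum, ← gSum]
  field_simp

/-- Counting solutions of a linear congruence. -/
theorem count_congr (n k T : ℕ) (e : ℤ) (hn : 1 ≤ n) (h : Nat.Coprime n k) :
    |(((Finset.Icc 1 T).filter (fun t : ℕ => (n : ℤ) ∣ (t : ℤ) * k + e)).card : ℝ) - T / n| ≤ 1 := by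
  have hc : IsCoprime (k : ℤ) (n : ℤ) := by
    rw [Nat.isCoprime_iff_coprime]; exact h.symm
  obtain ⟨a, b, hab⟩ := hc
  have hex : ∃ v : ℕ, ((v : ℤ)) ≡ -e * a [ZMOD n] := by
    refine ⟨((-e * a) % n).toNat, ?_⟩
    rw [Int.toNat_of_nonneg (Int.emod_nonneg _ (by positivity))]
    exact Int.mod_modEq _ _
  obtain ⟨v, hv⟩ := hex
  have hv' : (n : ℤ) ∣ (v : ℤ) * k + e := by
    obtain ⟨c, hc⟩ := hv.symm.dvd
    refine ⟨c * k + e * b, ?_⟩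
    have : (v : ℤ) = -e * a + n * c := by linarith
    rw [this]
    linear_combination (-e) * hab
  have heq : (Finset.Icc 1 T).filter (fun t : ℕ => (n : ℤ) ∣ (t : ℤ) * k + e) =
      (Finset.Ioc 0 T).filter (fun t : ℕ => t ≡ v [MOD n]) := by
    ext t
    simp only [Finset.mem_filter, Finset.mem_Icc, Finset.mem_Ioc]
    refine and_congr (by omega) ?_
    rw [← Int.natCast_modEq_iff]
    constructor
    · intro ht
      have h3 : (n : ℤ) ∣ ((v : ℤ) - t) * k := by
        have := dvd_sub hv' ht
        rwa [show (v : ℤ) * k + e - (t * k + e) = ((v : ℤ) - t) * k by ring] at this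
      refine Int.modEq_of_dvd ?_
      exact IsCoprime.dvd_of_dvd_mul_right (by rw [Nat.isCoprime_iff_coprime]; exact h) h3
    · intro ht
      have h3 := ht.dvd
      have := dvd_sub hv' (h3.mul_right (k : ℤ))
      rwa [show (v : ℤ) * k + e - (v - t) * k = (t : ℤ) * k + e by ring] at this
  rw [heq]
  have hcard := Nat.Ioc_filter_modEq_card 0 T (r := n) hn v
  set C := ((Finset.Ioc 0 T).filter (fun t : ℕ => t ≡ v [MOD n])).card
  have hnq : (0 : ℚ) < n := by exact_mod_cast hn
  have hfl1 := Int.floor_le (((T : ℚ) - v) / n)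
  have hfl2 := Int.lt_floor_add_one (((T : ℚ) - v) / n)
  have hfl3 := Int.floor_le ((((0 : ℕ) : ℚ) - v) / n)
  have hfl4 := Int.lt_floor_add_one ((((0 : ℕ) : ℚ) - v) / n)
  have hmono : ⌊(((0 : ℕ) : ℚ) - v) / n⌋ ≤ ⌊((T : ℚ) - v) / n⌋ := by
    apply Int.floor_le_floor
    gcongr
    exact Nat.zero_le _
  rw [max_eq_left (by linarith)] at hcard
  have hC : (C : ℚ) = (⌊((T : ℚ) - v) / n⌋ : ℚ) - (⌊(((0 : ℕ) : ℚ) - v) / n⌋ : ℚ) := by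
    exact_mod_cast hcard
  have hT : (T : ℚ) / n = ((T : ℚ) - v) / n - (((0 : ℕ) : ℚ) - v) / n := by
    push_cast; ring
  have hfin : |(C : ℚ) - T / n| ≤ 1 := by
    rw [abs_le, hC, hT]
    constructor <;> linarith
  have hfin' := (Rat.cast_le (K := ℝ)).2 hfin
  push_cast at hfin'
  exact hfin'

/-- The `t ≤ T` with `t k + e` prime. -/
noncomputable def pSet (k : ℕ) (e : ℤ) (T : ℕ) : Finset ℕ :=
  open Classical in
  (Finset.Icc 1 T).filter (fun t => ∃ p : ℕ, p.Prime ∧ (p : ℤ) = t * k + e)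

theorem selberg (k T D : ℕ) (e : ℤ) (hk : 1 ≤ k) (he : e = 1 ∨ e = -1) (hD : 1 ≤ D) :
    ((pSet k e T).card : ℝ) ≤ T / gSum k D + (D : ℝ) ^ 4 + (D + 1) := by
  classical
  set S : ℕ → ℝ := fun t => ∑ d ∈ dSet k D, if ((d : ℤ) ∣ (t : ℤ) * k + e) then d * lamW k D d else 0
    with hS
  -- main inequality
  have h1 : ((pSet k e T).card : ℝ) ≤ ∑ t ∈ Finset.Icc 1 T, S t ^ 2 + (D + 1) := by
    have hsub : pSet k e T ⊆ Finset.Icc 1 (D + 1) ∪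
        (pSet k e T).filter (fun t => S t = 1) := by
      intro t ht
      have ht' := ht
      simp only [pSet, Finset.mem_filter, Finset.mem_Icc] at ht'
      obtain ⟨⟨ht1, ht2⟩, p, hp, hpe⟩ := ht'
      rw [Finset.mem_union]
      by_cases hpD : p ≤ D
      · left
        rw [Finset.mem_Icc]
        refine ⟨ht1, ?_⟩
        have : (t : ℤ) * 1 ≤ t * k := by
          apply mul_le_mul_of_nonneg_left _ (by positivity)
          exact_mod_cast hk
        have : (p : ℤ) ≤ D := by exact_mod_cast hpD
        rcases he with rfl | rfl <;> omega
      · right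
        rw [Finset.mem_filter]
        refine ⟨ht, ?_⟩
        rw [hS]
        simp only
        rw [Finset.sum_eq_single_of_mem 1 (one_mem_dSet hD)]
        · simp [lamW_one hD]
        · intro d hd hd1
          rw [if_neg]
          rw [← hpe, Int.natCast_dvd_natCast, Nat.dvd_prime hp]
          have := (mem_dSet.1 hd).1.2
          omega
    have hc := (Finset.card_le_card hsub).trans (Finset.card_union_le _ _)
    rw [Nat.card_Icc] at hc
    have h2 : (((pSet k e T).filter (fun t => S t = 1)).card : ℝ) ≤ ∑ t ∈ Finset.Icc 1 T, S t ^ 2 := by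
      have : (((pSet k e T).filter (fun t => S t = 1)).card : ℝ) =
          ∑ t ∈ (pSet k e T).filter (fun t => S t = 1), S t ^ 2 := by
        rw [Finset.sum_congr rfl (g := fun _ => (1 : ℝ))]
        · simp
        · intro t ht
          rw [(Finset.mem_filter.1 ht).2, one_pow]
      rw [this]
      apply Finset.sum_le_sum_of_subset_of_nonneg
      · exact (Finset.filter_subset _ _).trans (Finset.filter_subset _ _)
      · intros; positivity
    have hc' : ((pSet k e T).card : ℝ) ≤ ((D + 1 + 1 - 1 : ℕ) : ℝ) +
        ((pSet k e T).filter (fun t => S t = 1)).card := by exact_mod_cast hc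
    simp only [Nat.add_sub_cancel] at hc'
    push_cast at hc'
    linarith
  have h2 : ∑ t ∈ Finset.Icc 1 T, S t ^ 2 = ∑ d ∈ dSet k D, ∑ d' ∈ dSet k D,
      (d * lamW k D d) * (d' * lamW k D d') *
        (((Finset.Icc 1 T).filter (fun t : ℕ => ((Nat.lcm d d' : ℕ) : ℤ) ∣ (t : ℤ) * k + e)).card : ℝ) := by
    have : ∀ t ∈ Finset.Icc 1 T, S t ^ 2 = ∑ d ∈ dSet k D, ∑ d' ∈ dSet k D,
        (d * lamW k D d) * (d' * lamW k D d') *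
          (if ((Nat.lcm d d' : ℕ) : ℤ) ∣ (t : ℤ) * k + e then 1 else 0) := by
      intro t _
      rw [hS]
      simp only
      rw [sq, Finset.sum_mul_sum]
      refine Finset.sum_congr rfl fun d _ => Finset.sum_congr rfl fun d' _ => ?_
      have : ((Nat.lcm d d' : ℕ) : ℤ) ∣ (t : ℤ) * k + e ↔
          ((d : ℤ) ∣ (t : ℤ) * k + e ∧ (d' : ℤ) ∣ (t : ℤ) * k + e) := by
        rw [Int.natCast_dvd, Int.natCast_dvd, Int.natCast_dvd, Nat.lcm_dvd_iff]
      simp only [this]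
      by_cases ha : (d : ℤ) ∣ (t : ℤ) * k + e <;> by_cases hb : (d' : ℤ) ∣ (t : ℤ) * k + e <;>
        simp [ha, hb]
    rw [Finset.sum_congr rfl this, Finset.sum_comm]
    refine Finset.sum_congr rfl fun d _ => ?_
    rw [Finset.sum_comm]
    refine Finset.sum_congr rfl fun d' _ => ?_
    rw [← Finset.mul_sum, Finset.sum_boole]
  have h3 : ∑ d ∈ dSet k D, ∑ d' ∈ dSet k D,
      (d * lamW k D d) * (d' * lamW k D d') *
        (((Finset.Icc 1 T).filter (fun t : ℕ => ((Nat.lcm d d' : ℕ) : ℤ) ∣ (t : ℤ) * k + e)).card : ℝ)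
      ≤ ∑ d ∈ dSet k D, ∑ d' ∈ dSet k D, (T * (lamW k D d * lamW k D d' * (Nat.gcd d d' : ℝ)) +
        (D : ℝ) * D) := by
    refine Finset.sum_le_sum fun d hd => Finset.sum_le_sum fun d' hd' => ?_
    have hd1 := mem_dSet.1 hd
    have hd1' := mem_dSet.1 hd'
    have hl : 1 ≤ Nat.lcm d d' := Nat.lcm_pos hd1.1.1 hd1'.1.1
    have hcop : Nat.Coprime (Nat.lcm d d') k := by
      apply Nat.Coprime.coprime_dvd_left (Nat.lcm_dvd_mul d d')
      exact hd1.2.2.mul_left hd1'.2.2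
    have hcc := count_congr (Nat.lcm d d') k T e hl hcop
    set C := (((Finset.Icc 1 T).filter
      (fun t : ℕ => ((Nat.lcm d d' : ℕ) : ℤ) ∣ (t : ℤ) * k + e)).card : ℝ)
    have hgl : (Nat.gcd d d' : ℝ) * (Nat.lcm d d' : ℝ) = d * d' := by
      exact_mod_cast Nat.gcd_mul_lcm d d'
    have hlr : (Nat.lcm d d' : ℝ) ≠ 0 := by positivity
    have hmain : (d * lamW k D d) * (d' * lamW k D d') * (T / (Nat.lcm d d' : ℝ)) =
        T * (lamW k D d * lamW k D d' * (Nat.gcd d d' : ℝ)) := by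
      rw [mul_div_assoc', div_eq_iff hlr]
      linear_combination (-(T * lamW k D d * lamW k D d')) * hgl
    have herr : (d * lamW k D d) * (d' * lamW k D d') * (C - T / (Nat.lcm d d' : ℝ)) ≤ D * D := by
      refine (le_abs_self _).trans ?_
      rw [abs_mul, abs_mul, abs_mul, abs_mul, Nat.abs_cast, Nat.abs_cast]
      have a1 : (d : ℝ) * |lamW k D d| ≤ D := by
        have : (d : ℝ) ≤ D := by exact_mod_cast hd1.1.2
        nlinarith [abs_lamW_le (k := k) hD d, abs_nonneg (lamW k D d)]
      have a2 : (d' : ℝ) * |lamW k D d'| ≤ D := by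
        have : (d' : ℝ) ≤ D := by exact_mod_cast hd1'.1.2
        nlinarith [abs_lamW_le (k := k) hD d', abs_nonneg (lamW k D d')]
      calc _ ≤ (D : ℝ) * D * 1 := by
            apply mul_le_mul (mul_le_mul a1 a2 (by positivity) (by positivity)) hcc
              (abs_nonneg _) (by positivity)
        _ = _ := mul_one _
    linarith [mul_sub ((d * lamW k D d) * (d' * lamW k D d')) C (T / (Nat.lcm d d' : ℝ))]
  have h4 : ∑ d ∈ dSet k D, ∑ d' ∈ dSet k D, (T * (lamW k D d * lamW k D d' * (Nat.gcd d d' : ℝ)) +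
        (D : ℝ) * D) = T / gSum k D + (dSet k D).card ^ 2 * ((D : ℝ) * D) := by
    simp_rw [Finset.sum_add_distrib, ← Finset.mul_sum]
    rw [lamW_quad hD]
    simp only [Finset.sum_const, nsmul_eq_mul]
    ring
  have h5 : ((dSet k D).card : ℝ) ≤ D := by
    have : (dSet k D).card ≤ D := by
      refine (Finset.card_filter_le _ _).trans ?_
      simp
    exact_mod_cast this
  have h6 : ((dSet k D).card : ℝ) ^ 2 * ((D : ℝ) * D) ≤ (D : ℝ) ^ 4 := by
    calc _ ≤ (D : ℝ) ^ 2 * ((D : ℝ) * D) := by gcongr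
      _ = _ := by ring
  linarith

/-! ### Lower bound for the Selberg sum -/

theorem sum_le_of_inj {α β : Type*} [DecidableEq β] (s : Finset α) (t : Finset β) (i : α → β)
    (f : α → ℝ) (g : β → ℝ) (hi : ∀ a ∈ s, i a ∈ t) (hinj : Set.InjOn i s)
    (hfg : ∀ a ∈ s, f a ≤ g (i a)) (hg : ∀ b ∈ t, 0 ≤ g b) :
    ∑ a ∈ s, f a ≤ ∑ b ∈ t, g b := by
  calc ∑ a ∈ s, f a ≤ ∑ a ∈ s, g (i a) := Finset.sum_le_sum hfg
    _ = ∑ b ∈ s.image i, g b := (Finset.sum_image hinj).symm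
    _ ≤ _ := Finset.sum_le_sum_of_subset_of_nonneg
        (Finset.image_subset_iff.2 hi) (fun b hb _ => hg b hb)

/-- Sum of reciprocals of the divisors. -/
noncomputable def sFun (k : ℕ) : ℝ := ∑ l ∈ k.divisors, (1 : ℝ) / l

theorem sum_inv_sq_le' (n : ℕ) : ∑ b ∈ Finset.Icc 1 n, (1 : ℝ) / (b : ℝ) ^ 2 ≤ 2 - 1 / n := by
  induction n with
  | zero => simp
  | succ n ih =>
    rw [Finset.sum_Icc_succ_top (by omega)]
    rcases Nat.eq_zero_or_pos n with rfl | hn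
    · norm_num
    have hn' : (0 : ℝ) < n := by exact_mod_cast hn
    have : (1 : ℝ) / ((n + 1 : ℕ) : ℝ) ^ 2 ≤ 1 / n - 1 / ((n + 1 : ℕ)) := by
      push_cast
      rw [div_sub_div _ _ (by positivity) (by positivity), div_le_div_iff₀ (by positivity) (by positivity)]
      nlinarith
    linarith

theorem sum_inv_sq_le (n : ℕ) : ∑ b ∈ Finset.Icc 1 n, (1 : ℝ) / (b : ℝ) ^ 2 ≤ 2 := by
  have := sum_inv_sq_le' n
  have : (0 : ℝ) ≤ 1 / n := by positivity
  linarith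

theorem decomp (k n D : ℕ) (hn : n ∈ Finset.Icc 1 D) (hk : 1 ≤ k) : ∃ x : ℕ × ℕ × ℕ,
    x ∈ (Finset.Icc 1 D ×ˢ k.divisors ×ˢ dSet k D) ∧ x.1 ^ 2 * (x.2.1 * x.2.2) = n := by
  rw [Finset.mem_Icc] at hn
  obtain ⟨a, b, ha, hb, hab, hsq⟩ := Nat.sq_mul_squarefree_of_pos (n := n) (by omega)
  obtain ⟨m, hm⟩ := Nat.gcd_dvd_left a k
  have hl : 0 < Nat.gcd a k := Nat.gcd_pos_of_pos_left _ ha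
  have hm0 : 0 < m := by
    rcases Nat.eq_zero_or_pos m with h | h
    · rw [h, mul_zero] at hm; omega
    · exact h
  have hbn : b ∣ n := ⟨b * a, by rw [← hab]; ring⟩
  have hmn : m ∣ n := ⟨b ^ 2 * Nat.gcd a k, by rw [← hab]; nth_rewrite 1 [hm]; ring⟩
  have hcop : Nat.Coprime (Nat.gcd a k) m := by
    apply Nat.coprime_of_squarefree_mul
    rw [← hm]; exact hsq
  refine ⟨(b, Nat.gcd a k, m), ?_, ?_⟩
  · simp only [Finset.mem_product, Finset.mem_Icc, Nat.mem_divisors, mem_dSet]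
    refine ⟨⟨hb, (Nat.le_of_dvd (by omega) hbn).trans hn.2⟩, ⟨Nat.gcd_dvd_right _ _, by omega⟩,
      ⟨hm0, (Nat.le_of_dvd (by omega) hmn).trans hn.2⟩,
      hsq.squarefree_of_dvd ⟨Nat.gcd a k, by nth_rewrite 1 [hm]; ring⟩, ?_⟩
    have h1 : Nat.gcd m k ∣ Nat.gcd a k := by
      apply Nat.gcd_dvd_gcd_of_dvd_left
      exact ⟨Nat.gcd a k, by nth_rewrite 1 [hm]; ring⟩
    exact Nat.eq_one_of_dvd_coprimes hcop h1 (Nat.gcd_dvd_left _ _)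
  · simp only
    rw [← hm, hab]

theorem gSum_lower (k D : ℕ) (hk : 1 ≤ k) (hD : 1 ≤ D) :
    Real.log D ≤ 2 * sFun k * gSum k D := by
  classical
  have h1 : Real.log D ≤ ∑ n ∈ Finset.Icc 1 D, (1 : ℝ) / n := by
    have h2 := log_add_one_le_harmonic D
    rw [harmonic_eq_sum_Icc] at h2
    push_cast at h2
    have : Real.log D ≤ Real.log (D + 1) := by
      apply Real.log_le_log
      · exact_mod_cast hD
      · linarith
    simp only [one_div]
    linarith
  have h2 : ∑ n ∈ Finset.Icc 1 D, (1 : ℝ) / n ≤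
      ∑ x ∈ (Finset.Icc 1 D ×ˢ k.divisors ×ˢ dSet k D),
        (1 / (x.1 : ℝ) ^ 2) * ((1 / (x.2.1 : ℝ)) * (1 / (x.2.2 : ℝ))) := by
    have hch := fun n : ℕ => fun hn : n ∈ Finset.Icc 1 D => decomp k n D hn hk
    choose! i hi1 hi2 using hch
    refine sum_le_of_inj _ _ i _ _ hi1 ?_ ?_ ?_
    · intro a ha b hb hab
      rw [← hi2 a ha, ← hi2 b hb, hab]
    · intro n hn
      apply le_of_eq
      have := hi2 n hn
      conv_lhs => rw [← this]
      push_cast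
      simp only [one_div, mul_inv]
    · intros; positivity
  have h3 : ∑ x ∈ (Finset.Icc 1 D ×ˢ k.divisors ×ˢ dSet k D),
        (1 / (x.1 : ℝ) ^ 2) * ((1 / (x.2.1 : ℝ)) * (1 / (x.2.2 : ℝ))) =
      (∑ b ∈ Finset.Icc 1 D, (1 : ℝ) / (b : ℝ) ^ 2) * (sFun k * ∑ m ∈ dSet k D, (1 : ℝ) / m) := by
    rw [Finset.sum_product, Finset.sum_mul]
    refine Finset.sum_congr rfl fun b _ => ?_
    dsimp only
    rw [← Finset.mul_sum]
    congr 1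
    rw [Finset.sum_product, sFun, Finset.sum_mul]
    refine Finset.sum_congr rfl fun l _ => ?_
    rw [Finset.mul_sum]
  have h4 : ∑ m ∈ dSet k D, (1 : ℝ) / m ≤ gSum k D := by
    refine Finset.sum_le_sum fun m hm => ?_
    have h0 : 0 < Nat.totient m := Nat.totient_pos.2 (mem_dSet.1 hm).1.1
    apply one_div_le_one_div_of_le
    · exact_mod_cast h0
    · exact_mod_cast Nat.totient_le m
  have h5 : 0 ≤ sFun k := Finset.sum_nonneg fun _ _ => by positivity
  have h6 : 0 ≤ ∑ m ∈ dSet k D, (1 : ℝ) / m := Finset.sum_nonneg fun _ _ => by positivity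
  calc Real.log D ≤ _ := h1
    _ ≤ _ := h2
    _ = _ := h3
    _ ≤ 2 * (sFun k * gSum k D) := by
      apply mul_le_mul (sum_inv_sq_le D) (mul_le_mul_of_nonneg_left h4 h5) (by positivity) zero_le_two
    _ = _ := by ring

/-- A Brun–Titchmarsh type bound. -/
theorem bt (k T D : ℕ) (e : ℤ) (hk : 1 ≤ k) (he : e = 1 ∨ e = -1) (hD : 2 ≤ D) :
    ((pSet k e T).card : ℝ) ≤ 2 * sFun k * T / Real.log D + (D : ℝ) ^ 4 + (D + 1) := by
  have h1 := selberg k T D e hk he (by omega)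
  have h2 := gSum_lower k D hk (by omega)
  have h3 := gSum_pos (k := k) (D := D) (by omega)
  have hlog : 0 < Real.log D := Real.log_pos (by exact_mod_cast hD)
  have h4 : (T : ℝ) / gSum k D ≤ 2 * sFun k * T / Real.log D := by
    rw [div_le_div_iff₀ h3 hlog]
    have : (0 : ℝ) ≤ T := by positivity
    nlinarith
  linarith

/-- `bt` with a cleaner error term. -/
theorem bt' (k T D : ℕ) (e : ℤ) (hk : 1 ≤ k) (he : e = 1 ∨ e = -1) (hD : 2 ≤ D) :
    ((pSet k e T).card : ℝ) ≤ 2 * sFun k * T / Real.log D + 2 * (D : ℝ) ^ 4 := by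
  have h1 := bt k T D e hk he hD
  have h2 : (2 : ℝ) ≤ D := by exact_mod_cast hD
  have h3 : (D : ℝ) + 1 ≤ D ^ 4 := by
    have h4 : (4 : ℝ) ≤ D ^ 2 := by nlinarith
    nlinarith
  linarith

theorem sFun_mul_prime (q n : ℕ) (hq : q.Prime) (hn : n ≠ 0) :
    sFun (q * n) ≤ (1 + 1 / (q : ℝ)) * sFun n := by
  classical
  have h1 : (q * n).divisors ⊆ n.divisors ∪ n.divisors.image (fun x => q * x) := by
    intro d hd
    rw [Nat.mem_divisors] at hd
    rw [Finset.mem_union, Finset.mem_image]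
    obtain ⟨h, _⟩ := hd
    by_cases hqd : q ∣ d
    · right
      obtain ⟨c, rfl⟩ := hqd
      exact ⟨c, Nat.mem_divisors.2 ⟨Nat.dvd_of_mul_dvd_mul_left hq.pos h, hn⟩, rfl⟩
    · left
      rw [Nat.mem_divisors]
      refine ⟨?_, hn⟩
      exact (Nat.Coprime.symm ((Nat.Prime.coprime_iff_not_dvd hq).2 hqd)).dvd_of_dvd_mul_left h
  have h2 : ∑ l ∈ n.divisors.image (fun x => q * x), (1 : ℝ) / l =
      ∑ x ∈ n.divisors, (1 : ℝ) / ((q * x : ℕ) : ℝ) := by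
    rw [Finset.sum_image]
    intro x _ y _ h
    exact Nat.eq_of_mul_eq_mul_left hq.pos h
  calc sFun (q * n) ≤ ∑ l ∈ n.divisors ∪ n.divisors.image (fun x => q * x), (1 : ℝ) / l :=
        Finset.sum_le_sum_of_subset_of_nonneg h1 (fun _ _ _ => by positivity)
    _ ≤ ∑ l ∈ n.divisors, (1 : ℝ) / l + ∑ l ∈ n.divisors.image (fun x => q * x), (1 : ℝ) / l := by
        rw [← Finset.sum_union_inter]
        have : 0 ≤ ∑ l ∈ n.divisors ∩ n.divisors.image (fun x => q * x), (1 : ℝ) / l :=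
          Finset.sum_nonneg fun _ _ => by positivity
        linarith
    _ = (1 + 1 / (q : ℝ)) * sFun n := by
        rw [h2, sFun, add_mul, one_mul, Finset.mul_sum]
        congr 1
        refine Finset.sum_congr rfl fun x _ => ?_
        push_cast
        simp only [one_div, mul_inv]

theorem sFun_one : sFun 1 = 1 := by simp [sFun]

theorem sFun_nonneg (k : ℕ) : 0 ≤ sFun k := Finset.sum_nonneg fun _ _ => by positivity

theorem sFun_prod (S : Finset ℕ) (hS : ∀ q ∈ S, q.Prime) :
    sFun (∏ q ∈ S, q) ≤ ∏ q ∈ S, (1 + 1 / (q : ℝ)) := by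
  classical
  induction S using Finset.induction_on with
  | empty => simp [sFun_one]
  | insert a S ha ih =>
    rw [Finset.prod_insert ha, Finset.prod_insert ha]
    have h0 : ∏ q ∈ S, q ≠ 0 :=
      Finset.prod_ne_zero_iff.2 fun q hq => (hS q (Finset.mem_insert_of_mem hq)).ne_zero
    refine (sFun_mul_prime a _ (hS a (Finset.mem_insert_self _ _)) h0).trans ?_
    apply mul_le_mul_of_nonneg_left _ (by positivity)
    exact ih fun q hq => hS q (Finset.mem_insert_of_mem hq)

theorem sFun_sq (q : ℕ) (hq : q.Prime) : sFun (q * q) ≤ 3 := by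
  have h1 := sFun_mul_prime q q hq hq.ne_zero
  have h2 := sFun_mul_prime q 1 hq one_ne_zero
  rw [mul_one, sFun_one, mul_one] at h2
  have h3 : 1 / (q : ℝ) ≤ 1 / 2 := by
    apply one_div_le_one_div_of_le (by norm_num)
    exact_mod_cast hq.two_le
  have h4 : 0 ≤ 1 / (q : ℝ) := by positivity
  nlinarith

theorem card_multiples_le (l M : ℕ) :
    (((Finset.Icc 1 M).filter (fun m => l ∣ m)).card : ℝ) ≤ (M : ℝ) / l := by
  have h : (Finset.Icc 1 M).filter (fun m => l ∣ m) = (Finset.Ioc 0 M).filter (fun m => l ∣ m) := by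
    ext m; simp only [Finset.mem_filter, Finset.mem_Icc, Finset.mem_Ioc]
    exact and_congr (by omega) Iff.rfl
  rw [h, Nat.Ioc_filter_dvd_card_eq_div]
  exact Nat.cast_div_le

theorem sFun_sum_le (M L : ℕ) (hL : 1 ≤ L) (A : Finset ℕ) (hA : A ⊆ Finset.Icc 1 M) :
    ∑ m ∈ A, sFun m ≤ L * A.card + M / L := by
  classical
  have h1 : ∀ m ∈ A, sFun m ≤ L + ∑ l ∈ Finset.Ioc L M, (if l ∣ m then (1 : ℝ) / l else 0) := by
    intro m hm
    have hm' := Finset.mem_Icc.1 (hA hm)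
    have hsub : m.divisors ⊆ Finset.Icc 1 L ∪ (Finset.Ioc L M).filter (fun l => l ∣ m) := by
      intro l hl
      rw [Nat.mem_divisors] at hl
      have := Nat.pos_of_dvd_of_pos hl.1 hm'.1
      have := Nat.le_of_dvd hm'.1 hl.1
      simp only [Finset.mem_union, Finset.mem_Icc, Finset.mem_filter, Finset.mem_Ioc]
      by_cases h : l ≤ L
      · left; omega
      · right; exact ⟨by omega, hl.1⟩
    have hdis : Disjoint (Finset.Icc 1 L) ((Finset.Ioc L M).filter (fun l => l ∣ m)) := by
      rw [Finset.disjoint_left]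
      intro l hl hl'
      simp only [Finset.mem_Icc, Finset.mem_filter, Finset.mem_Ioc] at hl hl'
      omega
    calc sFun m ≤ ∑ l ∈ Finset.Icc 1 L ∪ (Finset.Ioc L M).filter (fun l => l ∣ m), (1 : ℝ) / l :=
          Finset.sum_le_sum_of_subset_of_nonneg hsub (fun _ _ _ => by positivity)
      _ = ∑ l ∈ Finset.Icc 1 L, (1 : ℝ) / l +
            ∑ l ∈ Finset.Ioc L M, (if l ∣ m then (1 : ℝ) / l else 0) := by
          rw [Finset.sum_union hdis, Finset.sum_filter]
      _ ≤ _ := by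
          have : ∑ l ∈ Finset.Icc 1 L, (1 : ℝ) / l ≤ ∑ l ∈ Finset.Icc 1 L, (1 : ℝ) := by
            refine Finset.sum_le_sum fun l hl => ?_
            have hl1 : (1 : ℝ) ≤ l := by exact_mod_cast (Finset.mem_Icc.1 hl).1
            rw [div_le_one (by linarith)]
            exact hl1
          simp only [Finset.sum_const, Nat.card_Icc, Nat.add_sub_cancel, nsmul_eq_mul,
            mul_one] at this
          linarith
  have h2 : ∑ m ∈ A, ∑ l ∈ Finset.Ioc L M, (if l ∣ m then (1 : ℝ) / l else 0) ≤ M / L := by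
    calc _ ≤ ∑ m ∈ Finset.Icc 1 M, ∑ l ∈ Finset.Ioc L M, (if l ∣ m then (1 : ℝ) / l else 0) := by
          apply Finset.sum_le_sum_of_subset_of_nonneg hA
          intros
          refine Finset.sum_nonneg fun l _ => ?_
          split_ifs <;> positivity
      _ = ∑ l ∈ Finset.Ioc L M, (1 : ℝ) / l *
            (((Finset.Icc 1 M).filter (fun m => l ∣ m)).card : ℝ) := by
          rw [Finset.sum_comm]
          refine Finset.sum_congr rfl fun l _ => ?_
          rw [← Finset.sum_filter, Finset.sum_const, nsmul_eq_mul, mul_comm]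
      _ ≤ ∑ l ∈ Finset.Ioc L M, (M : ℝ) * ((l : ℝ) ^ 2)⁻¹ := by
          refine Finset.sum_le_sum fun l _ => ?_
          calc _ ≤ (1 : ℝ) / l * ((M : ℝ) / l) :=
                mul_le_mul_of_nonneg_left (card_multiples_le l M) (by positivity)
            _ = _ := by rw [div_mul_div_comm, one_mul, div_eq_mul_inv, sq]
      _ = M * ∑ l ∈ Finset.Ioc L M, ((l : ℝ) ^ 2)⁻¹ := by rw [Finset.mul_sum]
      _ ≤ M * (L : ℝ)⁻¹ := by
          apply mul_le_mul_of_nonneg_left _ (by positivity)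
          by_cases h : L ≤ M
          · refine (sum_Ioc_inv_sq_le_sub (by omega) h).trans ?_
            have : (0 : ℝ) ≤ (M : ℝ)⁻¹ := by positivity
            linarith
          · rw [Finset.Ioc_eq_empty (by omega), Finset.sum_empty]; positivity
      _ = _ := by rw [div_eq_mul_inv]
  have h3 := Finset.sum_le_sum h1
  rw [Finset.sum_add_distrib, Finset.sum_const, nsmul_eq_mul] at h3
  linarith

/-! ### Number of prime factors from a finite set of primes -/

/-- Number of prime factors in `Q`. -/
def om (Q : Finset ℕ) (n : ℕ) : ℕ := (Q.filter (fun q => q ∣ n)).card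

/-- Sum of reciprocals. -/
noncomputable def xSum (Q : Finset ℕ) : ℝ := ∑ q ∈ Q, (1 : ℝ) / q

/-- Integers with few prime factors in `Q`. -/
noncomputable def atyp (Q : Finset ℕ) (T : ℕ) : Finset ℕ :=
  open Classical in
  (Finset.Icc 1 T).filter (fun t => (om Q t : ℝ) ≤ 3 / 4 * xSum Q)

theorem card_multiples_ge (l M : ℕ) (hl : 1 ≤ l) :
    (M : ℝ) / l - 1 ≤ (((Finset.Icc 1 M).filter (fun m => l ∣ m)).card : ℝ) := by
  have h : (Finset.Icc 1 M).filter (fun m => l ∣ m) = (Finset.Ioc 0 M).filter (fun m => l ∣ m) := by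
    ext m; simp only [Finset.mem_filter, Finset.mem_Icc, Finset.mem_Ioc]
    exact and_congr (by omega) Iff.rfl
  rw [h, Nat.Ioc_filter_dvd_card_eq_div]
  have hl' : (0 : ℝ) < l := by exact_mod_cast hl
  have h1 : M < l * (M / l + 1) := Nat.lt_mul_div_succ M hl
  have h2 : (M : ℝ) < l * (((M / l : ℕ) : ℝ) + 1) := by exact_mod_cast h1
  have : (M : ℝ) / l < ((M / l : ℕ) : ℝ) + 1 := by
    rw [div_lt_iff₀ hl']; linarith
  linarith

theorem om_cast (Q : Finset ℕ) (n : ℕ) : (om Q n : ℝ) = ∑ q ∈ Q, if q ∣ n then (1 : ℝ) else 0 := by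
  rw [om, Finset.sum_boole]

theorem turan (Q : Finset ℕ) (hQ : ∀ q ∈ Q, q.Prime) (hX : 0 < xSum Q) (T : ℕ) :
    ((atyp Q T).card : ℝ) ≤ 16 * T / xSum Q + 32 * Q.card / xSum Q := by
  classical
  set X := xSum Q with hXd
  have s1 : (T : ℝ) * X - Q.card ≤ ∑ t ∈ Finset.Icc 1 T, (om Q t : ℝ) := by
    simp_rw [om_cast]
    rw [Finset.sum_comm]
    calc (T : ℝ) * X - Q.card = ∑ q ∈ Q, ((T : ℝ) / q - 1) := by
          rw [Finset.sum_sub_distrib, hXd, xSum, Finset.mul_sum]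
          simp [div_eq_mul_inv]
      _ ≤ _ := by
          refine Finset.sum_le_sum fun q hq => ?_
          rw [Finset.sum_boole]
          exact card_multiples_ge q T (hQ q hq).one_le
  have s2 : ∑ t ∈ Finset.Icc 1 T, (om Q t : ℝ) ^ 2 ≤ T * X ^ 2 + T * X := by
    have e1 : ∑ t ∈ Finset.Icc 1 T, (om Q t : ℝ) ^ 2 = ∑ q ∈ Q, ∑ q' ∈ Q,
        (((Finset.Icc 1 T).filter (fun t => q ∣ t ∧ q' ∣ t)).card : ℝ) := by
      have : ∀ t ∈ Finset.Icc 1 T, (om Q t : ℝ) ^ 2 = ∑ q ∈ Q, ∑ q' ∈ Q,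
          if q ∣ t ∧ q' ∣ t then (1 : ℝ) else 0 := by
        intro t _
        rw [om_cast, sq, Finset.sum_mul_sum]
        refine Finset.sum_congr rfl fun q _ => Finset.sum_congr rfl fun q' _ => ?_
        by_cases ha : q ∣ t <;> by_cases hb : q' ∣ t <;> simp [ha, hb]
      rw [Finset.sum_congr rfl this, Finset.sum_comm]
      refine Finset.sum_congr rfl fun q _ => ?_
      rw [Finset.sum_comm]
      refine Finset.sum_congr rfl fun q' _ => ?_
      rw [Finset.sum_boole]
    rw [e1]
    calc _ ≤ ∑ q ∈ Q, ∑ q' ∈ Q, ((T : ℝ) * ((1 / (q : ℝ)) * (1 / (q' : ℝ))) +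
          if q = q' then (T : ℝ) * (1 / (q : ℝ)) else 0) := by
          refine Finset.sum_le_sum fun q hq => Finset.sum_le_sum fun q' hq' => ?_
          by_cases h : q = q'
          · subst h
            rw [if_pos rfl]
            have h1 : (Finset.Icc 1 T).filter (fun t => q ∣ t ∧ q ∣ t) =
              (Finset.Icc 1 T).filter (fun t => q ∣ t) := by simp
            rw [h1]
            have := card_multiples_le q T
            have h2 : (0 : ℝ) ≤ (T : ℝ) * ((1 / (q : ℝ)) * (1 / (q : ℝ))) := by positivity
            have h3 : (T : ℝ) * (1 / (q : ℝ)) = T / q := mul_one_div _ _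
            linarith
          · rw [if_neg h, add_zero]
            have h1 : (Finset.Icc 1 T).filter (fun t => q ∣ t ∧ q' ∣ t) =
              (Finset.Icc 1 T).filter (fun t => q * q' ∣ t) := by
              ext t
              simp only [Finset.mem_filter]
              refine and_congr Iff.rfl ?_
              constructor
              · rintro ⟨h1, h2⟩
                exact Nat.Coprime.mul_dvd_of_dvd_of_dvd
                  ((Nat.coprime_primes (hQ q hq) (hQ q' hq')).2 h) h1 h2
              · intro h1
                exact ⟨(dvd_mul_right _ _).trans h1, (dvd_mul_left _ _).trans h1⟩
            rw [h1]
            refine (card_multiples_le (q * q') T).trans (le_of_eq ?_)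
            push_cast
            rw [one_div_mul_one_div, mul_one_div]
      _ = T * X ^ 2 + T * X := by
          simp_rw [Finset.sum_add_distrib, ← Finset.mul_sum]
          rw [Finset.sum_congr rfl (fun q hq => Finset.sum_ite_eq Q q _),
            Finset.sum_congr rfl (fun q hq => if_pos hq), ← Finset.mul_sum, ← Finset.sum_mul, ← xSum,
            ← hXd]
          ring
  have s3 : ((atyp Q T).card : ℝ) * (X / 4) ^ 2 ≤ ∑ t ∈ Finset.Icc 1 T, ((om Q t : ℝ) - X) ^ 2 := by
    calc _ = ∑ t ∈ atyp Q T, (X / 4) ^ 2 := by rw [Finset.sum_const, nsmul_eq_mul]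
      _ ≤ ∑ t ∈ atyp Q T, ((om Q t : ℝ) - X) ^ 2 := by
          refine Finset.sum_le_sum fun t ht => ?_
          have := (Finset.mem_filter.1 ht).2
          nlinarith
      _ ≤ _ := by
          apply Finset.sum_le_sum_of_subset_of_nonneg (Finset.filter_subset _ _)
          intros; positivity
  have s4 : ∑ t ∈ Finset.Icc 1 T, ((om Q t : ℝ) - X) ^ 2 = ∑ t ∈ Finset.Icc 1 T, (om Q t : ℝ) ^ 2
      - 2 * X * ∑ t ∈ Finset.Icc 1 T, (om Q t : ℝ) + T * X ^ 2 := by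
    rw [Finset.mul_sum, ← Finset.sum_sub_distrib]
    have : (T : ℝ) * X ^ 2 = ∑ t ∈ Finset.Icc 1 T, X ^ 2 := by simp
    rw [this, ← Finset.sum_add_distrib]
    refine Finset.sum_congr rfl fun t _ => by ring
  have s5 : ((atyp Q T).card : ℝ) * (X / 4) ^ 2 ≤ T * X + 2 * X * Q.card := by
    nlinarith
  rw [← add_div, le_div_iff₀ hX]
  have : ((atyp Q T).card : ℝ) * X * X ≤ (16 * T + 32 * Q.card) * X := by nlinarith
  exact le_of_mul_le_mul_right this hX

/-- The primes up to `N`. -/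
def pp (N : ℕ) : Finset ℕ := (Finset.Icc 1 N).filter Nat.Prime

theorem cnt_le (k N D : ℕ) (e : ℤ) (hk : 1 ≤ k) (he : e = 1 ∨ e = -1) (hD : 2 ≤ D) (hN : 1 ≤ N) :
    (((pp N).filter (fun p : ℕ => (k : ℤ) ∣ (p : ℤ) - e)).card : ℝ) ≤
      4 * N / Real.log D * (sFun k / k) + 2 * (D : ℝ) ^ 4 := by
  classical
  have hlog : 0 < Real.log D := Real.log_pos (by exact_mod_cast hD)
  have hk' : (0 : ℝ) < k := by exact_mod_cast hk
  have h1 : ((pp N).filter (fun p : ℕ => (k : ℤ) ∣ (p : ℤ) - e)).card ≤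
      (pSet k e ((N + 1) / k)).card := by
    have hch : ∀ p ∈ (pp N).filter (fun p : ℕ => (k : ℤ) ∣ (p : ℤ) - e),
        ∃ t : ℕ, t ∈ pSet k e ((N + 1) / k) ∧ (p : ℤ) = t * k + e := by
      intro p hp
      simp only [pp, Finset.mem_filter, Finset.mem_Icc] at hp
      obtain ⟨⟨⟨hp1, hpN⟩, hpp⟩, c, hc⟩ := hp
      have h2 := hpp.two_le
      have hcpos : 0 < c := by
        have : 0 < (k : ℤ) * c := by rw [← hc]; rcases he with rfl | rfl <;> omega
        exact pos_of_mul_pos_right this (by positivity)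
      lift c to ℕ using hcpos.le
      have hpe : (p : ℤ) = c * k + e := by linarith
      refine ⟨c, ?_, hpe⟩
      simp only [pSet, Finset.mem_filter, Finset.mem_Icc]
      refine ⟨⟨by exact_mod_cast hcpos, ?_⟩, p, hpp, hpe⟩
      rw [Nat.le_div_iff_mul_le hk]
      have : (c : ℤ) * k ≤ N + 1 := by rcases he with rfl | rfl <;> omega
      exact_mod_cast this
    choose! i hi1 hi2 using hch
    refine Finset.card_le_card_of_injOn i hi1 ?_
    intro a ha b hb hab
    have h1 := hi2 a ha
    have h2 := hi2 b hb
    rw [hab, ← h2] at h1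
    exact_mod_cast h1
  have h2 := bt' k ((N + 1) / k) D e hk he hD
  have h3 : (((N + 1) / k : ℕ) : ℝ) ≤ 2 * N / k := by
    refine (Nat.cast_div_le).trans ?_
    gcongr
    push_cast
    have : (1 : ℝ) ≤ N := by exact_mod_cast hN
    linarith
  have h4 : 2 * sFun k * (((N + 1) / k : ℕ) : ℝ) / Real.log D ≤ 4 * N / Real.log D * (sFun k / k) := by
    have hs := sFun_nonneg k
    calc _ ≤ 2 * sFun k * (2 * N / k) / Real.log D := by gcongr
      _ = _ := by field_simp; ring
  have h5 : (((pp N).filter (fun p : ℕ => (k : ℤ) ∣ (p : ℤ) - e)).card : ℝ) ≤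
      (pSet k e ((N + 1) / k)).card := by exact_mod_cast h1
  linarith

/-- `p - e` as a natural number. -/
def sh (e : ℤ) (p : ℕ) : ℕ := ((p : ℤ) - e).toNat

theorem sh_cast {e : ℤ} {p : ℕ} (he : e = 1 ∨ e = -1) (hp : p.Prime) : (sh e p : ℤ) = p - e := by
  have := hp.two_le
  rw [sh, Int.toNat_of_nonneg]
  rcases he with rfl | rfl <;> omega

theorem dvd_sh {e : ℤ} {p : ℕ} (he : e = 1 ∨ e = -1) (hp : p.Prime) (k : ℕ) :
    k ∣ sh e p ↔ (k : ℤ) ∣ (p : ℤ) - e := by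
  rw [← Int.natCast_dvd_natCast, sh_cast he hp]

theorem square_div_count (Q : Finset ℕ) (hQ : ∀ q ∈ Q, q.Prime) (w : ℕ) (hw : 1 ≤ w)
    (hQw : ∀ q ∈ Q, w < q) (N D : ℕ) (e : ℤ) (he : e = 1 ∨ e = -1) (hD : 2 ≤ D) (hN : 1 ≤ N) :
    (((pp N).filter (fun p : ℕ => ∃ q ∈ Q, q * q ∣ sh e p)).card : ℝ) ≤
      12 * N / Real.log D / w + 2 * Q.card * (D : ℝ) ^ 4 := by
  classical
  have hlog : 0 < Real.log D := Real.log_pos (by exact_mod_cast hD)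
  have h1 : (pp N).filter (fun p : ℕ => ∃ q ∈ Q, q * q ∣ sh e p) ⊆
      Q.biUnion (fun q => (pp N).filter (fun p : ℕ => ((q * q : ℕ) : ℤ) ∣ (p : ℤ) - e)) := by
    intro p hp
    rw [Finset.mem_filter] at hp
    obtain ⟨hp1, q, hq, hqp⟩ := hp
    rw [Finset.mem_biUnion]
    have hpp : p.Prime := (Finset.mem_filter.1 hp1).2
    exact ⟨q, hq, Finset.mem_filter.2 ⟨hp1, (dvd_sh he hpp _).1 hqp⟩⟩
  have h2 : (((pp N).filter (fun p : ℕ => ∃ q ∈ Q, q * q ∣ sh e p)).card : ℝ) ≤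
      ∑ q ∈ Q, (((pp N).filter (fun p : ℕ => ((q * q : ℕ) : ℤ) ∣ (p : ℤ) - e)).card : ℝ) := by
    exact_mod_cast (Finset.card_le_card h1).trans Finset.card_biUnion_le
  have h3 : ∑ q ∈ Q, (((pp N).filter (fun p : ℕ => ((q * q : ℕ) : ℤ) ∣ (p : ℤ) - e)).card : ℝ) ≤
      ∑ q ∈ Q, (12 * N / Real.log D * ((q : ℝ) ^ 2)⁻¹ + 2 * (D : ℝ) ^ 4) := by
    refine Finset.sum_le_sum fun q hq => ?_
    have hq' := hQ q hq
    refine (cnt_le (q * q) N D e (Nat.mul_pos hq'.pos hq'.pos) he hD hN).trans ?_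
    have hs := sFun_sq q hq'
    have hq0 : (0 : ℝ) < q := by exact_mod_cast hq'.pos
    have : 4 * (N : ℝ) / Real.log D * (sFun (q * q) / ((q * q : ℕ) : ℝ)) ≤
        4 * (N : ℝ) / Real.log D * (3 / ((q * q : ℕ) : ℝ)) := by
      gcongr
    have h5 : 4 * (N : ℝ) / Real.log D * (3 / ((q * q : ℕ) : ℝ)) =
      12 * N / Real.log D * ((q : ℝ) ^ 2)⁻¹ := by push_cast; field_simp; ring
    linarith
  have h4 : ∑ q ∈ Q, ((q : ℝ) ^ 2)⁻¹ ≤ (w : ℝ)⁻¹ := by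
    have hsub : Q ⊆ Finset.Ioc w (w + Q.sup id) := by
      intro q hq
      rw [Finset.mem_Ioc]
      exact ⟨hQw q hq, (Finset.le_sup (f := id) hq).trans (by simp)⟩
    refine (Finset.sum_le_sum_of_subset_of_nonneg hsub (fun _ _ _ => by positivity)).trans ?_
    refine (sum_Ioc_inv_sq_le_sub (by omega) (by omega)).trans ?_
    have : (0 : ℝ) ≤ ((w + Q.sup id : ℕ) : ℝ)⁻¹ := by positivity
    linarith
  rw [Finset.sum_add_distrib, ← Finset.mul_sum, Finset.sum_const, nsmul_eq_mul] at h3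
  have h5 : 12 * N / Real.log D * ∑ q ∈ Q, ((q : ℝ) ^ 2)⁻¹ ≤ 12 * N / Real.log D * (w : ℝ)⁻¹ := by
    gcongr
  rw [← div_eq_mul_inv] at h5
  linarith

theorem pow_om (Q : Finset ℕ) (hQ : ∀ q ∈ Q, q.Prime) (n : ℕ) :
    ((3 : ℝ) / 2) ^ om Q n = ∑ S ∈ Q.powerset, ((1 : ℝ) / 2) ^ S.card *
      (if (∏ q ∈ S, q) ∣ n then 1 else 0) := by
  classical
  have h1 : ((3 : ℝ) / 2) ^ om Q n = ∏ q ∈ Q, (1 + if q ∣ n then (1 : ℝ) / 2 else 0) := by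
    have : ∀ q ∈ Q, (1 + if q ∣ n then (1 : ℝ) / 2 else 0) = if q ∣ n then (3 : ℝ) / 2 else 1 := by
      intro q _; split_ifs <;> norm_num
    rw [Finset.prod_congr rfl this, ← Finset.prod_filter, Finset.prod_const, om]
  rw [h1, Finset.prod_one_add]
  refine Finset.sum_congr rfl fun S hS => ?_
  have hSQ := Finset.mem_powerset.1 hS
  by_cases h : (∏ q ∈ S, q) ∣ n
  · rw [if_pos h, mul_one, Finset.prod_congr rfl (g := fun _ => (1 : ℝ) / 2), Finset.prod_const]
    intro q hq
    rw [if_pos ((Finset.dvd_prod_of_mem (fun x : ℕ => x) hq).trans h)]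
  · rw [if_neg h, mul_zero]
    have : ∃ q ∈ S, ¬ q ∣ n := by
      by_contra hcon
      push Not at hcon
      exact h (Finset.prod_primes_dvd n (fun q hq => (hQ q (hSQ hq)).prime) hcon)
    obtain ⟨q, hq, hqn⟩ := this
    exact Finset.prod_eq_zero hq (if_neg hqn)

theorem log_three_half : (59 : ℝ) / 150 ≤ Real.log (3 / 2) := by
  have h1 : Real.log (2 ^ 4) ≤ Real.log ((3 / 2 : ℝ) ^ 7) := by
    apply Real.log_le_log <;> norm_num
  rw [Real.log_pow, Real.log_pow] at h1
  have := Real.log_two_gt_d9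
  push_cast at h1
  linarith

theorem chernoff (Q : Finset ℕ) (hQ : ∀ q ∈ Q, q.Prime) (hQw : ∀ q ∈ Q, 100 ≤ q)
    (N D : ℕ) (e : ℤ) (he : e = 1 ∨ e = -1) (hD : 2 ≤ D) (hN : 1 ≤ N) :
    (((pp N).filter (fun p : ℕ => 3 / 2 * xSum Q ≤ (om Q (sh e p) : ℝ))).card : ℝ) ≤
      4 * N / Real.log D * Real.exp (-(8 / 100) * xSum Q) + 2 ^ (Q.card + 1) * (D : ℝ) ^ 4 := by
  classical
  set X := xSum Q with hX
  have hX0 : 0 ≤ X := Finset.sum_nonneg fun _ _ => by positivity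
  have hlog : 0 < Real.log D := Real.log_pos (by exact_mod_cast hD)
  set P := (pp N).filter (fun p : ℕ => 3 / 2 * X ≤ (om Q (sh e p) : ℝ)) with hP
  have h1 : (P.card : ℝ) * Real.exp (59 / 100 * X) ≤ ∑ p ∈ pp N, ((3 : ℝ) / 2) ^ om Q (sh e p) := by
    calc _ = ∑ p ∈ P, Real.exp (59 / 100 * X) := by rw [Finset.sum_const, nsmul_eq_mul]
      _ ≤ ∑ p ∈ P, ((3 : ℝ) / 2) ^ om Q (sh e p) := by
          refine Finset.sum_le_sum fun p hp => ?_
          have h2 := (Finset.mem_filter.1 hp).2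
          rw [← Real.exp_log (show (0 : ℝ) < (3 / 2) ^ om Q (sh e p) by positivity), Real.log_pow]
          apply Real.exp_le_exp.2
          have := log_three_half
          nlinarith
      _ ≤ _ := by
          apply Finset.sum_le_sum_of_subset_of_nonneg (Finset.filter_subset _ _)
          intros; positivity
  have h2 : ∑ p ∈ pp N, ((3 : ℝ) / 2) ^ om Q (sh e p) = ∑ S ∈ Q.powerset, ((1 : ℝ) / 2) ^ S.card *
      (((pp N).filter (fun p : ℕ => ((∏ q ∈ S, q : ℕ) : ℤ) ∣ (p : ℤ) - e)).card : ℝ) := by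
    simp_rw [pow_om Q hQ]
    rw [Finset.sum_comm]
    refine Finset.sum_congr rfl fun S _ => ?_
    rw [← Finset.mul_sum, Finset.sum_boole]
    congr 3
    refine Finset.filter_congr fun p hp => ?_
    exact dvd_sh he (Finset.mem_filter.1 hp).2 _
  have h3 : ∑ S ∈ Q.powerset, ((1 : ℝ) / 2) ^ S.card *
      (((pp N).filter (fun p : ℕ => ((∏ q ∈ S, q : ℕ) : ℤ) ∣ (p : ℤ) - e)).card : ℝ) ≤
      ∑ S ∈ Q.powerset, (4 * N / Real.log D * ∏ q ∈ S, ((1 : ℝ) / 2 * (1 + 1 / (q : ℝ)) / q) +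
        2 * (D : ℝ) ^ 4) := by
    refine Finset.sum_le_sum fun S hS => ?_
    have hSQ := Finset.mem_powerset.1 hS
    have hpos : ∀ q ∈ S, (0 : ℝ) < q := fun q hq => by exact_mod_cast (hQ q (hSQ hq)).pos
    have hk : 1 ≤ ∏ q ∈ S, q := Finset.prod_pos fun q hq => (hQ q (hSQ hq)).pos
    have hc := cnt_le (∏ q ∈ S, q) N D e hk he hD hN
    have hs := sFun_prod S fun q hq => hQ q (hSQ hq)
    have hk' : (0 : ℝ) < ((∏ q ∈ S, q : ℕ) : ℝ) := by exact_mod_cast hk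
    have hpow : ((1 : ℝ) / 2) ^ S.card ≤ 1 := pow_le_one₀ (by norm_num) (by norm_num)
    have hpow0 : 0 ≤ ((1 : ℝ) / 2) ^ S.card := by positivity
    have hprod : ∏ q ∈ S, ((1 : ℝ) / 2 * (1 + 1 / (q : ℝ)) / q) =
        ((1 : ℝ) / 2) ^ S.card * ((∏ q ∈ S, (1 + 1 / (q : ℝ))) / ((∏ q ∈ S, q : ℕ) : ℝ)) := by
      rw [Finset.prod_div_distrib, Finset.prod_mul_distrib, Finset.prod_const]
      push_cast
      rw [mul_div_assoc]
    rw [hprod]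
    calc _ ≤ ((1 : ℝ) / 2) ^ S.card * (4 * N / Real.log D *
          (sFun (∏ q ∈ S, q) / ((∏ q ∈ S, q : ℕ) : ℝ)) + 2 * (D : ℝ) ^ 4) := by gcongr
      _ ≤ ((1 : ℝ) / 2) ^ S.card * (4 * N / Real.log D *
          ((∏ q ∈ S, (1 + 1 / (q : ℝ))) / ((∏ q ∈ S, q : ℕ) : ℝ)) + 2 * (D : ℝ) ^ 4) := by gcongr
      _ ≤ _ := by
          rw [mul_add]
          have : ((1 : ℝ) / 2) ^ S.card * (2 * (D : ℝ) ^ 4) ≤ 1 * (2 * (D : ℝ) ^ 4) := by gcongr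
          linarith
  have h4 : ∑ S ∈ Q.powerset, (4 * N / Real.log D * ∏ q ∈ S, ((1 : ℝ) / 2 * (1 + 1 / (q : ℝ)) / q) +
        2 * (D : ℝ) ^ 4) = 4 * N / Real.log D * ∏ q ∈ Q, (1 + (1 : ℝ) / 2 * (1 + 1 / (q : ℝ)) / q) +
        2 ^ (Q.card + 1) * (D : ℝ) ^ 4 := by
    rw [Finset.sum_add_distrib, ← Finset.mul_sum, Finset.prod_one_add, Finset.sum_const,
      Finset.card_powerset, nsmul_eq_mul]
    push_cast
    ring
  have h5 : ∏ q ∈ Q, (1 + (1 : ℝ) / 2 * (1 + 1 / (q : ℝ)) / q) ≤ Real.exp (51 / 100 * X) := by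
    rw [hX, xSum, Finset.mul_sum, Real.exp_sum]
    refine Finset.prod_le_prod (fun _ _ => by positivity) fun q hq => ?_
    have hq' : (100 : ℝ) ≤ q := by exact_mod_cast hQw q hq
    have h6 : 1 / (q : ℝ) ≤ 1 / 100 := one_div_le_one_div_of_le (by norm_num) hq'
    have h7 : 0 ≤ 1 / (q : ℝ) := by positivity
    have h8 : (1 : ℝ) / 2 * (1 + 1 / (q : ℝ)) / q ≤ 51 / 100 * (1 / (q : ℝ)) := by
      rw [div_eq_mul_one_div]
      apply mul_le_mul_of_nonneg_right _ h7
      linarith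
    have := Real.add_one_le_exp (51 / 100 * (1 / (q : ℝ)))
    linarith
  have h6 : (P.card : ℝ) * Real.exp (59 / 100 * X) ≤
      4 * N / Real.log D * Real.exp (51 / 100 * X) + 2 ^ (Q.card + 1) * (D : ℝ) ^ 4 := by
    have : 4 * N / Real.log D * ∏ q ∈ Q, (1 + (1 : ℝ) / 2 * (1 + 1 / (q : ℝ)) / q) ≤
      4 * N / Real.log D * Real.exp (51 / 100 * X) := by gcongr
    linarith
  have hE : 0 < Real.exp (59 / 100 * X) := Real.exp_pos _
  have hE1 : 1 ≤ Real.exp (59 / 100 * X) := Real.one_le_exp (by positivity)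
  have hmul : Real.exp (-(8 / 100) * X) * Real.exp (59 / 100 * X) = Real.exp (51 / 100 * X) := by
    rw [← Real.exp_add]; ring_nf
  have hpos : (0 : ℝ) ≤ 2 ^ (Q.card + 1) * (D : ℝ) ^ 4 := by positivity
  refine le_of_mul_le_mul_right ?_ hE
  rw [add_mul, mul_assoc, hmul]
  nlinarith

/-! ### Counting the exceptional primes -/

theorem fib_le_two_pow (k : ℕ) : Nat.fib k ≤ 2 ^ k := by
  induction k using Nat.strong_induction_on with
  | _ k ih =>
    match k, ih with
    | 0, _ => simp
    | 1, _ => simp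
    | (n + 2), ih =>
      rw [Nat.fib_add_two]
      have h1 := ih n (by omega)
      have h2 := ih (n + 1) (by omega)
      have : 2 ^ (n + 2) = 2 ^ (n + 1) + 2 ^ n + 2 ^ n := by ring
      omega

/-- Large primes dividing `F_k`. -/
def eSet (N k : ℕ) : Finset ℕ := (pp N).filter (fun p => Nat.sqrt N < p ∧ p ∣ Nat.fib k)

theorem eSet_card (N k : ℕ) (hN : 2 ≤ N) (hk : 1 ≤ k) :
    ((eSet N k).card : ℝ) ≤ 2 * k / Real.log N := by
  have hlog : 0 < Real.log N := Real.log_pos (by exact_mod_cast hN)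
  have hN0 : (0 : ℝ) < N := by positivity
  have h1 : (∏ p ∈ eSet N k, p) ∣ Nat.fib k := by
    apply Finset.prod_primes_dvd
    · intro p hp
      exact (Finset.mem_filter.1 (Finset.mem_filter.1 hp).1).2.prime
    · intro p hp
      exact (Finset.mem_filter.1 hp).2.2
  have h2 : (∏ p ∈ eSet N k, p) ≤ 2 ^ k :=
    (Nat.le_of_dvd (Nat.fib_pos.2 hk) h1).trans (fib_le_two_pow k)
  have hpos : ∀ p ∈ eSet N k, (0 : ℝ) < p := fun p hp => by
    exact_mod_cast (Finset.mem_filter.1 (Finset.mem_filter.1 hp).1).2.pos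
  have h3 : Real.log (∏ p ∈ eSet N k, (p : ℝ)) ≤ Real.log (2 ^ k) := by
    apply Real.log_le_log (Finset.prod_pos hpos)
    have h2' := (Nat.cast_le (α := ℝ)).2 h2
    push_cast at h2'
    exact h2'
  rw [Real.log_prod (fun p hp => (hpos p hp).ne'), Real.log_pow] at h3
  have h4 : ∑ p ∈ eSet N k, Real.log N / 2 ≤ ∑ p ∈ eSet N k, Real.log p := by
    refine Finset.sum_le_sum fun p hp => ?_
    have hs := (Finset.mem_filter.1 hp).2.1
    rw [Nat.sqrt_lt'] at hs
    have h5 : Real.log N ≤ Real.log ((p : ℝ) ^ 2) := by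
      apply Real.log_le_log hN0
      exact_mod_cast hs.le
    rw [Real.log_pow] at h5
    push_cast at h5
    linarith
  rw [Finset.sum_const, nsmul_eq_mul] at h4
  have h6 : Real.log 2 ≤ 1 := by have := Real.log_two_lt_d9; linarith
  have hk0 : (0 : ℝ) ≤ k := by positivity
  rw [le_div_iff₀ hlog]
  nlinarith

theorem biUnion_card_le (S : Finset ℕ) (f : ℕ → Finset ℕ) (c : ℝ)
    (h : ∀ k ∈ S, ((f k).card : ℝ) ≤ c) : ((S.biUnion f).card : ℝ) ≤ S.card * c := by
  have h1 : ((S.biUnion f).card : ℝ) ≤ ∑ k ∈ S, ((f k).card : ℝ) := by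
    exact_mod_cast Finset.card_biUnion_le
  refine h1.trans ((Finset.sum_le_sum h).trans ?_)
  rw [Finset.sum_const, nsmul_eq_mul]

/-- The primes `z m + e` with `m` atypical. -/
noncomputable def fSet (Q : Finset ℕ) (e : ℤ) (M K : ℕ) : Finset ℕ :=
  (atyp Q M).biUnion (fun m => (pSet m e K).image (fun t : ℕ => ((t : ℤ) * m + e).toNat))

theorem fSet_card (Q : Finset ℕ) (e : ℤ) (he : e = 1 ∨ e = -1) (M K L D : ℕ) (hL : 1 ≤ L)
    (hD : 2 ≤ D) :
    ((fSet Q e M K).card : ℝ) ≤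
      2 * K / Real.log D * (L * (atyp Q M).card + M / L) + 2 * M * (D : ℝ) ^ 4 := by
  classical
  have hlog : 0 < Real.log D := Real.log_pos (by exact_mod_cast hD)
  have hsub : atyp Q M ⊆ Finset.Icc 1 M := Finset.filter_subset _ _
  have h1 : ((fSet Q e M K).card : ℝ) ≤ ∑ m ∈ atyp Q M, ((pSet m e K).card : ℝ) := by
    have : (fSet Q e M K).card ≤ ∑ m ∈ atyp Q M, (pSet m e K).card :=
      Finset.card_biUnion_le.trans (Finset.sum_le_sum fun m _ => Finset.card_image_le)
    exact_mod_cast this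
  have h2 : ∑ m ∈ atyp Q M, ((pSet m e K).card : ℝ) ≤
      ∑ m ∈ atyp Q M, (2 * K / Real.log D * sFun m + 2 * (D : ℝ) ^ 4) := by
    refine Finset.sum_le_sum fun m hm => ?_
    refine (bt' m K D e (Finset.mem_Icc.1 (hsub hm)).1 he hD).trans (le_of_eq ?_)
    ring
  rw [Finset.sum_add_distrib, ← Finset.mul_sum, Finset.sum_const, nsmul_eq_mul] at h2
  have h3 := sFun_sum_le M L hL (atyp Q M) hsub
  have h4 : 2 * K / Real.log D * ∑ m ∈ atyp Q M, sFun m ≤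
      2 * K / Real.log D * (L * (atyp Q M).card + M / L) := by gcongr
  have h5 : ((atyp Q M).card : ℝ) ≤ M := by
    have := Finset.card_le_card hsub
    rw [Nat.card_Icc, Nat.add_sub_cancel] at this
    exact_mod_cast this
  have h6 : ((atyp Q M).card : ℝ) * (2 * (D : ℝ) ^ 4) ≤ M * (2 * (D : ℝ) ^ 4) := by gcongr
  linarith

theorem om_add_le (Q : Finset ℕ) (z m : ℕ) (hQ : ∀ q ∈ Q, ¬ q * q ∣ z * m) :
    om Q z + om Q m ≤ om Q (z * m) := by
  classical
  rw [om, om, om, ← Finset.card_union_of_disjoint]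
  · apply Finset.card_le_card
    intro q hq
    simp only [Finset.mem_union, Finset.mem_filter] at hq ⊢
    rcases hq with ⟨h, h'⟩ | ⟨h, h'⟩
    · exact ⟨h, h'.mul_right _⟩
    · exact ⟨h, h'.mul_left _⟩
  · rw [Finset.disjoint_left]
    intro q h1 h2
    rw [Finset.mem_filter] at h1 h2
    exact hQ q h1.1 (Nat.mul_dvd_mul h1.2 h2.2)

/-- Primes in the residue-type categories. -/
noncomputable def gSet (Q : Finset ℕ) (e : ℤ) (N M K : ℕ) : Finset ℕ :=
  open Classical in
  (pp N).filter (fun p : ℕ => ∃ q ∈ Q, q * q ∣ sh e p) ∪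
    (pp N).filter (fun p : ℕ => 3 / 2 * xSum Q ≤ (om Q (sh e p) : ℝ)) ∪ fSet Q e M K

theorem cover (Q : Finset ℕ) (N K0 K1 M p : ℕ) (hM : N + 1 ≤ M * K0) (hs5 : 5 ≤ Nat.sqrt N)
    (hp : p ∈ pp N) (hps : Nat.sqrt N < p)
    (hz : ∃ k, 1 ≤ k ∧ k ≤ K1 ∧ p ∣ Nat.fib k) :
    p ∈ (Finset.Icc 1 K0).biUnion (eSet N) ∪ (atyp Q K1).biUnion (eSet N) ∪
      (gSet Q 1 N M K1 ∪ gSet Q (-1) N M K1) := by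
  classical
  have hp' := hp
  simp only [pp, Finset.mem_filter, Finset.mem_Icc] at hp'
  obtain ⟨⟨_, hpN⟩, hpp⟩ := hp'
  obtain ⟨z, m, hz1, hzK, hpz, hzm⟩ := rank_exists p hpp (by omega) (by omega) K1 hz
  have hE : p ∈ eSet N z := Finset.mem_filter.2 ⟨hp, hps, hpz⟩
  by_cases hz0 : z ≤ K0
  · exact Finset.mem_union_left _ (Finset.mem_union_left _
      (Finset.mem_biUnion.2 ⟨z, Finset.mem_Icc.2 ⟨hz1, hz0⟩, hE⟩))
  by_cases hza : z ∈ atyp Q K1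
  · exact Finset.mem_union_left _ (Finset.mem_union_right _
      (Finset.mem_biUnion.2 ⟨z, hza, hE⟩))
  apply Finset.mem_union_right
  have key : ∀ e : ℤ, (e = 1 ∨ e = -1) → (p : ℤ) = z * m + e → p ∈ gSet Q e N M K1 := by
    intro e he hpe
    have hsh : sh e p = z * m := by
      have := sh_cast he hpp
      have h2 : (sh e p : ℤ) = ((z * m : ℕ) : ℤ) := by push_cast; linarith
      exact_mod_cast h2
    rw [gSet]
    by_cases hsq : ∃ q ∈ Q, q * q ∣ sh e p
    · exact Finset.mem_union_left _ (Finset.mem_union_left _ (Finset.mem_filter.2 ⟨hp, hsq⟩))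
    by_cases hom : 3 / 2 * xSum Q ≤ (om Q (sh e p) : ℝ)
    · exact Finset.mem_union_left _ (Finset.mem_union_right _ (Finset.mem_filter.2 ⟨hp, hom⟩))
    apply Finset.mem_union_right
    have hzm1 : 1 ≤ z * m := by
      have := hpp.two_le
      have h2 : (1 : ℤ) ≤ ((z * m : ℕ) : ℤ) := by
        push_cast; rcases he with rfl | rfl <;> omega
      exact_mod_cast h2
    have hzmN : z * m ≤ N + 1 := by
      have h2 : ((z * m : ℕ) : ℤ) ≤ N + 1 := by
        push_cast; rcases he with rfl | rfl <;> omega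
      exact_mod_cast h2
    have hm1 : 1 ≤ m := by
      rcases Nat.eq_zero_or_pos m with h | h
      · subst h; omega
      · exact h
    have hmM : m ≤ M := by
      by_contra hcon
      have h1 : M * K0 < m * z := Nat.mul_lt_mul_of_lt_of_le (by omega) (by omega) (by omega)
      rw [mul_comm m z] at h1
      omega
    have hza' : 3 / 4 * xSum Q < (om Q z : ℝ) := by
      by_contra hcon
      exact hza (Finset.mem_filter.2 ⟨Finset.mem_Icc.2 ⟨hz1, hzK⟩, not_lt.1 hcon⟩)
    rw [hsh] at hsq hom
    push Not at hsq
    have hadd := om_add_le Q z m hsq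
    have hadd' : (om Q z : ℝ) + om Q m ≤ om Q (z * m) := by exact_mod_cast hadd
    rw [fSet, Finset.mem_biUnion]
    refine ⟨m, Finset.mem_filter.2 ⟨Finset.mem_Icc.2 ⟨hm1, hmM⟩, ?_⟩, ?_⟩
    · rw [not_le] at hom; linarith
    · rw [Finset.mem_image]
      refine ⟨z, ?_, ?_⟩
      · exact Finset.mem_filter.2 ⟨Finset.mem_Icc.2 ⟨hz1, hzK⟩, p, hpp, hpe⟩
      · rw [← hpe]; simp
  rcases hzm with h | h
  · exact Finset.mem_union_left _ (key 1 (Or.inl rfl) (by rw [h]; push_cast; ring))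
  · refine Finset.mem_union_right _ (key (-1) (Or.inr rfl) ?_)
    have : ((p + 1 : ℕ) : ℤ) = ((z * m : ℕ) : ℤ) := by rw [h]
    push_cast at this
    linarith

theorem gSet_card (Q : Finset ℕ) (hQ : ∀ q ∈ Q, q.Prime) (w : ℕ) (hw : 100 ≤ w)
    (hQw : ∀ q ∈ Q, w < q) (e : ℤ) (he : e = 1 ∨ e = -1) (N M K L D : ℕ) (hL : 1 ≤ L)
    (hD : 2 ≤ D) (hN : 1 ≤ N) :
    ((gSet Q e N M K).card : ℝ) ≤
      12 * N / Real.log D / w + 2 * Q.card * (D : ℝ) ^ 4 +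
      (4 * N / Real.log D * Real.exp (-(8 / 100) * xSum Q) + 2 ^ (Q.card + 1) * (D : ℝ) ^ 4) +
      (2 * K / Real.log D * (L * (atyp Q M).card + M / L) + 2 * M * (D : ℝ) ^ 4) := by
  classical
  have h1 := square_div_count Q hQ w (by omega) hQw N D e he hD hN
  have h2 := chernoff Q hQ (fun q hq => by have := hQw q hq; omega) N D e he hD hN
  have h3 := fSet_card Q e he M K L D hL hD
  have h4 : (gSet Q e N M K).card ≤ ((pp N).filter (fun p : ℕ => ∃ q ∈ Q, q * q ∣ sh e p)).card +
    ((pp N).filter (fun p : ℕ => 3 / 2 * xSum Q ≤ (om Q (sh e p) : ℝ))).card +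
      (fSet Q e M K).card := by
    refine (Finset.card_union_le _ _).trans ?_
    refine Nat.add_le_add_right ((Finset.card_union_le _ _).trans ?_) _
    apply le_of_eq
    congr
  have h5 : ((gSet Q e N M K).card : ℝ) ≤
      (((pp N).filter (fun p : ℕ => ∃ q ∈ Q, q * q ∣ sh e p)).card : ℝ) +
    (((pp N).filter (fun p : ℕ => 3 / 2 * xSum Q ≤ (om Q (sh e p) : ℝ))).card : ℝ) +
      ((fSet Q e M K).card : ℝ) := by exact_mod_cast h4
  linarith

theorem main_count (Q : Finset ℕ) (hQ : ∀ q ∈ Q, q.Prime) (w : ℕ) (hw : 100 ≤ w)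
    (hQw : ∀ q ∈ Q, w < q) (N K0 K1 M L D : ℕ) (hM : N + 1 ≤ M * K0) (hs5 : 5 ≤ Nat.sqrt N)
    (hL : 1 ≤ L) (hD : 2 ≤ D) (hN : 2 ≤ N) (B : Finset ℕ) (hB : B ⊆ pp N)
    (hBz : ∀ p ∈ B, Nat.sqrt N < p → ∃ k, 1 ≤ k ∧ k ≤ K1 ∧ p ∣ Nat.fib k) :
    (B.card : ℝ) ≤ Nat.sqrt N + K0 * (2 * K0 / Real.log N) +
      (atyp Q K1).card * (2 * K1 / Real.log N) +
      2 * (12 * N / Real.log D / w + 2 * Q.card * (D : ℝ) ^ 4 +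
      (4 * N / Real.log D * Real.exp (-(8 / 100) * xSum Q) + 2 ^ (Q.card + 1) * (D : ℝ) ^ 4) +
      (2 * K1 / Real.log D * (L * (atyp Q M).card + M / L) + 2 * M * (D : ℝ) ^ 4)) := by
  classical
  have hlog : 0 < Real.log N := Real.log_pos (by exact_mod_cast hN)
  have hsub : B ⊆ Finset.Icc 1 (Nat.sqrt N) ∪
      ((Finset.Icc 1 K0).biUnion (eSet N) ∪ (atyp Q K1).biUnion (eSet N) ∪
      (gSet Q 1 N M K1 ∪ gSet Q (-1) N M K1)) := by
    intro p hp
    by_cases hps : Nat.sqrt N < p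
    · exact Finset.mem_union_right _ (cover Q N K0 K1 M p hM hs5 (hB hp) hps (hBz p hp hps))
    · apply Finset.mem_union_left
      have := (Finset.mem_filter.1 (hB hp)).2.pos
      exact Finset.mem_Icc.2 ⟨this, not_lt.1 hps⟩
  have hc : B.card ≤ Nat.sqrt N + (((Finset.Icc 1 K0).biUnion (eSet N)).card +
      ((atyp Q K1).biUnion (eSet N)).card +
      ((gSet Q 1 N M K1).card + (gSet Q (-1) N M K1).card)) := by
    refine (Finset.card_le_card hsub).trans ((Finset.card_union_le _ _).trans ?_)
    refine Nat.add_le_add (by simp) ((Finset.card_union_le _ _).trans ?_)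
    exact Nat.add_le_add (Finset.card_union_le _ _) (Finset.card_union_le _ _)
  have hc' : (B.card : ℝ) ≤ Nat.sqrt N + ((((Finset.Icc 1 K0).biUnion (eSet N)).card : ℝ) +
      (((atyp Q K1).biUnion (eSet N)).card : ℝ) +
      (((gSet Q 1 N M K1).card : ℝ) + ((gSet Q (-1) N M K1).card : ℝ))) := by exact_mod_cast hc
  have h1 := biUnion_card_le (Finset.Icc 1 K0) (eSet N) (2 * K0 / Real.log N) (by
    intro k hk
    rw [Finset.mem_Icc] at hk
    refine (eSet_card N k hN hk.1).trans ?_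
    have : (k : ℝ) ≤ K0 := by exact_mod_cast hk.2
    gcongr)
  have h2 := biUnion_card_le (atyp Q K1) (eSet N) (2 * K1 / Real.log N) (by
    intro k hk
    have hk := Finset.mem_Icc.1 (Finset.mem_filter.1 hk).1
    refine (eSet_card N k hN hk.1).trans ?_
    have : (k : ℝ) ≤ K1 := by exact_mod_cast hk.2
    gcongr)
  rw [Nat.card_Icc, Nat.add_sub_cancel] at h1
  have h3 := gSet_card Q hQ w hw hQw 1 (Or.inl rfl) N M K1 L D hL hD (by omega)
  have h4 := gSet_card Q hQ w hw hQw (-1) (Or.inr rfl) N M K1 L D hL hD (by omega)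
  linarith

theorem exists_Q (w : ℕ) (X : ℝ) : ∃ Q : Finset ℕ, (∀ q ∈ Q, q.Prime) ∧ (∀ q ∈ Q, w < q) ∧
    X ≤ xSum Q := by
  classical
  have h := not_summable_one_div_on_primes
  have h2 := (not_summable_iff_tendsto_nat_atTop_of_nonneg (fun n => by
    apply Set.indicator_nonneg; intros; positivity)).1 h
  obtain ⟨n, hn⟩ := (h2.eventually_ge_atTop (X + ∑ i ∈ Finset.range (w + 1), (1 : ℝ) / i)).exists
  refine ⟨(Finset.range n).filter (fun q => q.Prime ∧ w < q), ?_, ?_, ?_⟩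
  · intro q hq; exact (Finset.mem_filter.1 hq).2.1
  · intro q hq; exact (Finset.mem_filter.1 hq).2.2
  · have h3 : ∑ i ∈ Finset.range n, Set.indicator {p | Nat.Prime p} (fun n : ℕ => (1 : ℝ) / n) i ≤
        xSum ((Finset.range n).filter (fun q => q.Prime ∧ w < q)) +
          ∑ i ∈ Finset.range (w + 1), (1 : ℝ) / i := by
      have h4 : ∑ i ∈ Finset.range n, Set.indicator {p | Nat.Prime p} (fun n : ℕ => (1 : ℝ) / n) i =
          ∑ i ∈ (Finset.range n).filter Nat.Prime, (1 : ℝ) / i := by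
        rw [Finset.sum_filter]
        refine Finset.sum_congr rfl fun i _ => ?_
        simp [Set.indicator_apply]
      rw [h4]
      have hsub : (Finset.range n).filter Nat.Prime ⊆
          (Finset.range n).filter (fun q => q.Prime ∧ w < q) ∪ Finset.range (w + 1) := by
        intro q hq
        simp only [Finset.mem_filter, Finset.mem_union, Finset.mem_range] at hq ⊢
        by_cases hw : w < q
        · left; exact ⟨hq.1, hq.2, hw⟩
        · right; omega
      refine (Finset.sum_le_sum_of_subset_of_nonneg hsub (fun _ _ _ => by positivity)).trans ?_
      have h5 := Finset.sum_union_inter (s₁ := (Finset.range n).filter (fun q => q.Prime ∧ w < q))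
        (s₂ := Finset.range (w + 1)) (f := fun i : ℕ => (1 : ℝ) / i)
      have h6 : 0 ≤ ∑ i ∈ (Finset.range n).filter (fun q => q.Prime ∧ w < q) ∩ Finset.range (w + 1),
        (1 : ℝ) / i := Finset.sum_nonneg fun _ _ => by positivity
      rw [xSum]
      linarith
    linarith

/-! ### Asymptotics and the final assembly -/

theorem arith_bound (s y ℓ lD d4 C L w X q E N K0 K1 M A1 A2 P b : ℝ)
    (hs : 0 ≤ s) (hsy : s ≤ y ^ 2) (hy : 1 ≤ y) (hsN : s ^ 2 ≤ N) (hℓ : 1 ≤ ℓ)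
    (hlD : ℓ / 16 ≤ lD) (hd4 : d4 ≤ 16 * y) (hd0 : 0 ≤ d4) (hC : 1 ≤ C) (hL : 1 ≤ L) (hw : 1 ≤ w)
    (hX : 1 ≤ X) (hq : 0 ≤ q) (hE : 0 ≤ E) (hP : 0 ≤ P) (hK00 : 0 ≤ K0) (hK0 : K0 ≤ s / C)
    (hK10 : 0 ≤ K1) (hK1 : K1 ≤ 64 * s) (hM0 : 0 ≤ M) (hM : M ≤ 8 * C * s)
    (hA1 : A1 ≤ 16 * K1 / X + 32 * q / X) (hA2 : A2 ≤ 16 * M / X + 32 * q / X)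
    (hA10 : 0 ≤ A1) (hA20 : 0 ≤ A2)
    (hb : b ≤ s + K0 * (2 * K0 / ℓ) + A1 * (2 * K1 / ℓ) +
      2 * (12 * N / lD / w + 2 * q * d4 + (4 * N / lD * E + P * d4) +
      (2 * K1 / lD * (L * A2 + M / L) + 2 * M * d4))) :
    b ≤ N / ℓ * (2 / C + 131072 / X + 384 / w + 128 * E + 524288 * C * L / X + 32768 * C / L) +
      (1 + 4096 * q / X + 2 * (32 * q + 16 * P + 65536 * q * L / X + 256 * C)) * y ^ 3 := by
  have hℓ0 : 0 < ℓ := by linarith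
  have hlD0 : 0 < lD := by linarith
  have hN0 : 0 ≤ N := le_trans (by positivity) hsN
  have hy0 : 0 < y := by linarith
  have hC0 : 0 < C := by linarith
  have hX0 : 0 < X := by linarith
  have hL0 : 0 < L := by linarith
  have hw0 : 0 < w := by linarith
  have hyy : y ^ 2 ≤ y ^ 3 := pow_le_pow_right₀ hy (by norm_num)
  have hy1 : y ≤ y ^ 3 := by simpa using pow_le_pow_right₀ hy (show 1 ≤ 3 by norm_num)
  have hsy3 : s ≤ y ^ 3 := hsy.trans hyy
  have hsl : s / ℓ ≤ y ^ 3 := (div_le_self hs hℓ).trans hsy3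
  have hssl : s ^ 2 / ℓ ≤ N / ℓ := by gcongr
  have hNl : 0 ≤ N / ℓ := by positivity
  have hNlD : N / lD ≤ 16 * (N / ℓ) := by
    rw [div_le_iff₀ hlD0]
    have : N / ℓ * ℓ = N := div_mul_cancel₀ _ hℓ0.ne'
    nlinarith
  have hslD : s / lD ≤ 16 * (s / ℓ) := by
    rw [div_le_iff₀ hlD0]
    have : s / ℓ * ℓ = s := div_mul_cancel₀ _ hℓ0.ne'
    have : 0 ≤ s / ℓ := by positivity
    nlinarith
  have t2 : K0 * (2 * K0 / ℓ) ≤ N / ℓ * (2 / C) := by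
    calc K0 * (2 * K0 / ℓ) ≤ (s / C) * (2 * (s / C) / ℓ) := by gcongr
      _ = s ^ 2 / ℓ * (2 / C) * (1 / C) := by field_simp
      _ ≤ N / ℓ * (2 / C) * 1 := by
          gcongr
          rw [div_le_one hC0]; exact hC
      _ = _ := mul_one _
  have t3 : A1 * (2 * K1 / ℓ) ≤ N / ℓ * (131072 / X) + 4096 * q / X * y ^ 3 := by
    calc A1 * (2 * K1 / ℓ) ≤ (16 * (64 * s) / X + 32 * q / X) * (2 * (64 * s) / ℓ) := by
          apply mul_le_mul _ (by gcongr) (by positivity) (by positivity)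
          exact hA1.trans (by gcongr)
      _ = s ^ 2 / ℓ * (131072 / X) + 4096 * q / X * (s / ℓ) := by field_simp; ring
      _ ≤ _ := by gcongr
  have t4 : 12 * N / lD / w ≤ N / ℓ * (192 / w) := by
    calc 12 * N / lD / w = 12 * (N / lD) / w := by ring
      _ ≤ 12 * (16 * (N / ℓ)) / w := by gcongr
      _ = _ := by ring
  have t5 : 2 * q * d4 ≤ 32 * q * y ^ 3 := by
    calc 2 * q * d4 ≤ 2 * q * (16 * y ^ 3) := by gcongr; linarith
      _ = _ := by ring
  have t6 : 4 * N / lD * E ≤ N / ℓ * (64 * E) := by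
    calc 4 * N / lD * E = 4 * (N / lD) * E := by ring
      _ ≤ 4 * (16 * (N / ℓ)) * E := by gcongr
      _ = _ := by ring
  have t7 : P * d4 ≤ 16 * P * y ^ 3 := by
    calc P * d4 ≤ P * (16 * y ^ 3) := by gcongr; linarith
      _ = _ := by ring
  have t8 : 2 * K1 / lD * (L * A2 + M / L) ≤
      N / ℓ * (262144 * C * L / X + 16384 * C / L) + 65536 * q * L / X * y ^ 3 := by
    calc 2 * K1 / lD * (L * A2 + M / L)
        ≤ (2048 * (s / ℓ)) * (L * (16 * (8 * C * s) / X + 32 * q / X) + 8 * C * s / L) := by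
          apply mul_le_mul _ _ (by positivity) (by positivity)
          · calc 2 * K1 / lD ≤ 2 * (64 * s) / lD := by gcongr
              _ = 128 * (s / lD) := by ring
              _ ≤ 128 * (16 * (s / ℓ)) := by gcongr
              _ = _ := by ring
          · have : A2 ≤ 16 * (8 * C * s) / X + 32 * q / X := hA2.trans (by gcongr)
            gcongr
      _ = s ^ 2 / ℓ * (262144 * C * L / X + 16384 * C / L) + 65536 * q * L / X * (s / ℓ) := by
          field_simp; ring
      _ ≤ _ := by gcongr
  have t9 : 2 * M * d4 ≤ 256 * C * y ^ 3 := by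
    calc 2 * M * d4 ≤ 2 * (8 * C * y ^ 2) * (16 * y) := by
          apply mul_le_mul _ hd4 hd0 (by positivity)
          have : 8 * C * s ≤ 8 * C * y ^ 2 := by gcongr
          linarith
      _ = _ := by ring
  calc b ≤ _ := hb
    _ ≤ y ^ 3 + N / ℓ * (2 / C) + (N / ℓ * (131072 / X) + 4096 * q / X * y ^ 3) +
      2 * (N / ℓ * (192 / w) + 32 * q * y ^ 3 + (N / ℓ * (64 * E) + 16 * P * y ^ 3) +
      (N / ℓ * (262144 * C * L / X + 16384 * C / L) + 65536 * q * L / X * y ^ 3 +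
        256 * C * y ^ 3)) := by gcongr
    _ = _ := by ring

theorem hM_aux (N s C : ℕ) (hC : 1 ≤ C) (hsC : C + 5 ≤ s) (hNs : N < (s + 1) * (s + 1)) :
    N + 1 ≤ (2 * C * (s + 3)) * (s / C) := by
  have h0 : 1 ≤ s / C := (Nat.one_le_div_iff (by omega)).2 (by omega)
  have h1 : s < C * (s / C + 1) := Nat.lt_mul_div_succ s (by omega)
  generalize s / C = t at *
  have h2 : s ≤ 2 * C * t := by nlinarith
  calc N + 1 ≤ (s + 1) * (s + 1) := hNs
    _ ≤ (s + 3) * s := by nlinarith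
    _ ≤ (s + 3) * (2 * C * t) := Nat.mul_le_mul_left _ h2
    _ = _ := by ring

set_option maxHeartbeats 1600000 in
theorem param_bound (η : ℝ) (hη : 0 < η) : ∃ N₀ : ℕ, ∀ N : ℕ, N₀ ≤ N → ∀ B : Finset ℕ, B ⊆ pp N →
    (∀ p ∈ B, Nat.sqrt N < p → ∃ k, 1 ≤ k ∧ k ≤ 16 * (2 * (Nat.sqrt N + 1)) ∧ p ∣ Nat.fib k) →
    (B.card : ℝ) ≤ 7 * η * (N / Real.log N) := by
  obtain ⟨C, hC⟩ := exists_nat_ge (max 1 (2 / η))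
  obtain ⟨w, hw⟩ := exists_nat_ge (max 100 (384 / η))
  obtain ⟨L, hL⟩ := exists_nat_ge (max 1 (32768 * C / η))
  obtain ⟨Q, hQ, hQw, hX⟩ := exists_Q w (max (max 1 (131072 / η))
    (max (1600 / η) (524288 * C * L / η)))
  rw [max_le_iff] at hC hw hL
  rw [max_le_iff, max_le_iff, max_le_iff] at hX
  obtain ⟨hC1, hC2⟩ := hC
  obtain ⟨hw1, hw2⟩ := hw
  obtain ⟨hL1, hL2⟩ := hL
  obtain ⟨⟨hX1, hX2⟩, hX3, hX4⟩ := hX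
  set X := xSum Q with hXd
  set q : ℝ := (Q.card : ℝ) with hq
  set P : ℝ := 2 ^ (Q.card + 1) with hP
  set E : ℝ := Real.exp (-(8 / 100) * X) with hE
  set K : ℝ := (1 + 4096 * q / X + 2 * (32 * q + 16 * P + 65536 * q * L / X + 256 * C)) with hK
  have hX0 : 0 < X := by linarith
  have hCpos : (0 : ℝ) < C := by linarith
  have hLpos : (0 : ℝ) < L := by linarith
  have hK0 : 0 < K := by positivity
  have hE1 : E ≤ 100 / (8 * X) := by
    rw [hE, show -(8 / 100) * X = -(8 / 100 * X) by ring, Real.exp_neg]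
    rw [inv_le_comm₀ (Real.exp_pos _) (by positivity), inv_div]
    have := Real.add_one_le_exp (8 / 100 * X)
    linarith
  have c1 : 2 / (C : ℝ) ≤ η := by
    rw [div_le_iff₀ hCpos]; rw [div_le_iff₀ hη] at hC2; linarith
  have c2 : 131072 / X ≤ η := by
    rw [div_le_iff₀ hX0]; rw [div_le_iff₀ hη] at hX2; linarith
  have c3 : 384 / (w : ℝ) ≤ η := by
    rw [div_le_iff₀ (by linarith)]; rw [div_le_iff₀ hη] at hw2; linarith
  have c4 : 128 * E ≤ η := by
    have : 1600 / X ≤ η := by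
      rw [div_le_iff₀ hX0]; rw [div_le_iff₀ hη] at hX3; linarith
    calc 128 * E ≤ 128 * (100 / (8 * X)) := by gcongr
      _ = 1600 / X := by field_simp; norm_num
      _ ≤ η := this
  have c5 : 524288 * C * L / X ≤ η := by
    rw [div_le_iff₀ hX0]; rw [div_le_iff₀ hη] at hX4; linarith
  have c6 : 32768 * C / (L : ℝ) ≤ η := by
    rw [div_le_iff₀ hLpos]; rw [div_le_iff₀ hη] at hL2; linarith
  -- eventual conditions
  have ev1 : ∀ᶠ N : ℕ in Filter.atTop, K * Real.log N ≤ η * (N : ℝ) ^ ((1 : ℝ) / 4) := by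
    have h1 := (isLittleO_log_rpow_atTop (show (0 : ℝ) < 1 / 4 by norm_num)).bound
      (show 0 < η / K by positivity)
    have h2 := tendsto_natCast_atTop_atTop (R := ℝ) |>.eventually h1
    filter_upwards [h2, Filter.eventually_ge_atTop 1] with N hN hN1
    have hlog : 0 ≤ Real.log N := Real.log_natCast_nonneg N
    rw [Real.norm_of_nonneg hlog, Real.norm_of_nonneg (by positivity), div_mul_eq_mul_div,
      le_div_iff₀ hK0] at hN
    linarith
  obtain ⟨N1, hN1⟩ := Filter.eventually_atTop.1 ev1
  refine ⟨max N1 (max 100 ((C + 5) * (C + 5))), fun N hN B hB hBz => ?_⟩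
  have hNN1 : N1 ≤ N := (le_max_left _ _).trans hN
  have hN100 : 100 ≤ N := ((le_max_left _ _).trans (le_max_right _ _)).trans hN
  have hNC : (C + 5) * (C + 5) ≤ N := ((le_max_right _ _).trans (le_max_right _ _)).trans hN
  obtain ⟨s, hs⟩ : ∃ s, s = Nat.sqrt N := ⟨_, rfl⟩
  rw [← hs] at hBz
  have hsC : C + 5 ≤ s := hs ▸ Nat.le_sqrt.2 hNC
  have hC1' : 1 ≤ C := by exact_mod_cast hC1
  have hL1' : 1 ≤ L := by exact_mod_cast hL1
  have hw1' : 100 ≤ w := by exact_mod_cast hw1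
  have hNr : (100 : ℝ) ≤ N := by exact_mod_cast hN100
  set r : ℝ := (N : ℝ) ^ ((1 : ℝ) / 16) with hr
  have hr1 : 1 < r := Real.one_lt_rpow (by linarith) (by norm_num)
  have hr16 : r ^ 16 = N := by
    rw [hr, ← Real.rpow_natCast, ← Real.rpow_mul (by linarith)]; norm_num
  have hr4 : r ^ 4 = (N : ℝ) ^ ((1 : ℝ) / 4) := by
    rw [hr, ← Real.rpow_natCast, ← Real.rpow_mul (by linarith)]; norm_num
  have hlogr : Real.log r = Real.log N / 16 := by
    rw [← hr16, Real.log_pow]; push_cast; ring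
  have hlog1 : 1 ≤ Real.log N := by
    rw [Real.le_log_iff_exp_le (by linarith)]
    have := Real.exp_one_lt_d9
    linarith
  set D := ⌈r⌉₊ with hD
  have hD2 : 2 ≤ D := by
    rw [hD]
    have : 1 < ⌈r⌉₊ := Nat.lt_ceil.2 (by exact_mod_cast hr1)
    omega
  have hDr : r ≤ D := Nat.le_ceil r
  have hDr2 : (D : ℝ) ≤ 2 * r := by
    have := Nat.ceil_lt_add_one (show 0 ≤ r by linarith)
    linarith
  have hlD : Real.log N / 16 ≤ Real.log D := by
    rw [← hlogr]; exact Real.log_le_log (by linarith) hDr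
  have hd4 : (D : ℝ) ^ 4 ≤ 16 * r ^ 4 := by
    calc (D : ℝ) ^ 4 ≤ (2 * r) ^ 4 := by gcongr
      _ = _ := by ring
  have hsN : s * s ≤ N := by rw [hs]; exact Nat.sqrt_le N
  have hNs : N < (s + 1) * (s + 1) := by rw [hs]; exact Nat.lt_succ_sqrt N
  have hsN' : (s : ℝ) ^ 2 ≤ N := by rw [sq]; exact_mod_cast hsN
  have hsr : (s : ℝ) ≤ (r ^ 4) ^ 2 := by
    have : (s : ℝ) ^ 2 ≤ ((r ^ 4) ^ 2) ^ 2 := by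
      calc (s : ℝ) ^ 2 ≤ N := hsN'
        _ = _ := by rw [← hr16]; ring
    exact le_of_sq_le_sq this (by positivity)
  have hs1 : (1 : ℝ) ≤ s := by exact_mod_cast (show 1 ≤ s by omega)
  have hK0C : 1 ≤ s / C := (Nat.one_le_div_iff (by omega)).2 (by omega)
  have hM := hM_aux N s C hC1' hsC hNs
  have hmain := main_count Q hQ w hw1' hQw N (s / C) (16 * (2 * (s + 1))) (2 * C * (s + 3)) L D hM
    (by rw [← hs]; omega) hL1' hD2 (by omega) B hB (by rw [← hs]; exact hBz)
  rw [← hs] at hmain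
  have hfin := arith_bound s (r ^ 4) (Real.log N) (Real.log D) ((D : ℝ) ^ 4) C L w X q E N
    ((s / C : ℕ) : ℝ) ((16 * (2 * (s + 1)) : ℕ) : ℝ) ((2 * C * (s + 3) : ℕ) : ℝ)
    ((atyp Q (16 * (2 * (s + 1)))).card : ℝ) ((atyp Q (2 * C * (s + 3))).card : ℝ) P (B.card : ℝ)
    (by linarith) hsr (one_le_pow₀ hr1.le) hsN' hlog1 hlD hd4 (by positivity) hC1 hL1 (by linarith)
    hX1 (by positivity) (by positivity) (by positivity) (by positivity) Nat.cast_div_le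
    (by positivity) (by push_cast; linarith) (by positivity) (by push_cast; nlinarith)
    (turan Q hQ hX0 _) (turan Q hQ hX0 _) (by positivity) (by positivity) hmain
  rw [← hK] at hfin
  have hR : 0 ≤ N / Real.log N := by positivity
  have hlow : K * (r ^ 4) ^ 3 ≤ η * (N / Real.log N) := by
    have h1 := hN1 N hNN1
    rw [← hr4] at h1
    rw [mul_div_assoc', le_div_iff₀ (by linarith)]
    calc K * (r ^ 4) ^ 3 * Real.log N = (K * Real.log N) * (r ^ 4) ^ 3 := by ring
      _ ≤ (η * r ^ 4) * (r ^ 4) ^ 3 := by gcongr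
      _ = η * r ^ 16 := by ring
      _ = _ := by rw [hr16]
  calc (B.card : ℝ) ≤ _ := hfin
    _ ≤ N / Real.log N * (η + η + η + η + η + η) + η * (N / Real.log N) := by gcongr
    _ = _ := by ring

theorem pi_lower : ∃ N₀ : ℕ, ∀ N : ℕ, N₀ ≤ N →
    (N : ℝ) / Real.log N ≤ 2 * (N.primeCounting : ℝ) := by
  have h1 := Real.isLittleO_log_id_atTop.bound (show (0 : ℝ) < 1 / 20 by norm_num)
  have h2 := tendsto_natCast_atTop_atTop (R := ℝ) |>.eventually h1
  obtain ⟨N1, hN1⟩ := Filter.eventually_atTop.1 h2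
  refine ⟨max N1 100, fun N hN => ?_⟩
  have h3 := hN1 N ((le_max_left _ _).trans hN)
  have hN100 : 100 ≤ N := (le_max_right _ _).trans hN
  have hNr : (100 : ℝ) ≤ N := by exact_mod_cast hN100
  have hlog : 0 < Real.log N := Real.log_pos (by linarith)
  rw [Real.norm_of_nonneg hlog.le, id, Real.norm_of_nonneg (by linarith)] at h3
  have h4 := Chebyshev.pi_ge N
  have h5 : Real.log (N + 1) ≤ Real.log N + Real.log 2 := by
    rw [← Real.log_mul (by positivity) (by norm_num)]
    apply Real.log_le_log <;> linarith
  have h6 := Real.log_two_gt_d9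
  have h7 := Real.log_two_lt_d9
  rw [div_le_iff₀ hlog] at h4 ⊢
  nlinarith

theorem eventually_range (ε : ℝ) (hε : 0 < ε) : ∃ N₀ : ℕ, ∀ N : ℕ, N₀ ≤ N →
    ((12 * (2 * (Nat.sqrt N + 1)) : ℕ) : ℝ) ≤ (N : ℝ) ^ ((1 : ℝ) / 2 + ε) := by
  have h1 := ((tendsto_rpow_atTop hε).comp (tendsto_natCast_atTop_atTop (R := ℝ))).eventually_ge_atTop 48
  obtain ⟨N1, hN1⟩ := Filter.eventually_atTop.1 h1
  refine ⟨max N1 1, fun N hN => ?_⟩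
  have h3 := hN1 N ((le_max_left _ _).trans hN)
  have hN1' : 1 ≤ N := (le_max_right _ _).trans hN
  simp only [Function.comp_apply] at h3
  have hN0 : (0 : ℝ) < N := by exact_mod_cast hN1'
  rw [Real.rpow_add hN0, ← Real.sqrt_eq_rpow]
  have hs : (Nat.sqrt N : ℝ) ≤ Real.sqrt N := Real.nat_sqrt_le_real_sqrt
  have hs1 : (1 : ℝ) ≤ Real.sqrt N := Real.one_le_sqrt.2 (by exact_mod_cast hN1')
  push_cast
  calc (12 : ℝ) * (2 * (Nat.sqrt N + 1)) ≤ Real.sqrt N * 48 := by linarith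
    _ ≤ _ := by gcongr

/-- **Theorem 3 (sums of 16 Fibonacci numbers mod almost all primes).**
For every `ε > 0` and `δ > 0`, for all sufficiently large `N`, for all but at most
`δ·π(N)` primes `p ≤ N`: every integer `λ` can be written as
`F_{n₁} + … + F_{n₁₆} ≡ λ (mod p)` with positive integers `n_i ≤ N^{1/2+ε}`. -/
theorem stmt_6 (ε δ : ℝ) (hε : 0 < ε) (hδ : 0 < δ) :
    ∃ N₀ : ℕ, ∀ N : ℕ, N₀ ≤ N →
      ({p : ℕ | p ≤ N ∧ p.Prime ∧
          ¬ (∀ lam : ℤ, ∃ n : Fin 16 → ℕ,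
              (∀ i, 1 ≤ n i ∧ (n i : ℝ) ≤ (N : ℝ) ^ ((1 : ℝ) / 2 + ε)) ∧
              (∑ i, (Nat.fib (n i) : ℤ)) ≡ lam [ZMOD p])}.ncard : ℝ)
        ≤ δ * (N.primeCounting : ℝ) := by
  classical
  obtain ⟨N1, h1⟩ := param_bound (δ / 14) (by positivity)
  obtain ⟨N2, h2⟩ := pi_lower
  obtain ⟨N3, h3⟩ := eventually_range ε hε
  refine ⟨max (max N1 N2) (max N3 36), fun N hN => ?_⟩
  have hN1 : N1 ≤ N := by omega
  have hN2 : N2 ≤ N := by omega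
  have hN3 : N3 ≤ N := by omega
  have hN36 : 6 * 6 ≤ N := by omega
  have hs6 : 6 ≤ Nat.sqrt N := Nat.le_sqrt.2 hN36
  set S := {p : ℕ | p ≤ N ∧ p.Prime ∧
          ¬ (∀ lam : ℤ, ∃ n : Fin 16 → ℕ,
              (∀ i, 1 ≤ n i ∧ (n i : ℝ) ≤ (N : ℝ) ^ ((1 : ℝ) / 2 + ε)) ∧
              (∑ i, (Nat.fib (n i) : ℤ)) ≡ lam [ZMOD p])} with hS
  have hfin : S.Finite := (Set.finite_Iic N).subset (fun p hp => hp.1)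
  have hB := h1 N hN1 hfin.toFinset
    (by
      intro p hp
      have hp' := (Set.Finite.mem_toFinset hfin).1 hp
      exact Finset.mem_filter.2 ⟨Finset.mem_Icc.2 ⟨hp'.2.1.one_le, hp'.1⟩, hp'.2.1⟩)
    (by
      intro p hp hsp
      obtain ⟨hpN, hpp, hbad⟩ := (Set.Finite.mem_toFinset hfin).1 hp
      by_contra hcon
      apply hbad
      intro lam
      have hlt : N < (Nat.sqrt N + 1) * (Nat.sqrt N + 1) := Nat.lt_succ_sqrt N
      obtain ⟨n, hn, hsum⟩ := large_rank p (2 * (Nat.sqrt N + 1)) hpp (by omega) (by omega)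
        (fun k hk1 hk2 hd => hcon ⟨k, hk1, hk2, hd⟩) (by nlinarith) lam
      refine ⟨n, fun i => ⟨(hn i).1, ?_⟩, hsum⟩
      exact le_trans (by exact_mod_cast (hn i).2) (h3 N hN3))
  rw [Set.ncard_eq_toFinset_card S hfin]
  have hpi := h2 N hN2
  calc (hfin.toFinset.card : ℝ) ≤ 7 * (δ / 14) * (N / Real.log N) := hB
    _ = δ / 2 * (N / Real.log N) := by ring
    _ ≤ δ / 2 * (2 * (N.primeCounting : ℝ)) := by gcongr
    _ = _ := by ring
end

section
/- Let 0 < ε < 1/2. There exists a positive integer s with s < 100/ε (one may take s = 4(⌊8/ε⌋ − 1)) such that for every δ > 0 there exists N₀ with the following property: for all N ≥ N₀, the number of primes p ≤ N for which the following FAILS is at most δ·π(N): for every integer λ there exist positive integers n₁, …, n_s with n_i ≤ N^ε for all i, such that F_{n₁} + F_{n₂} + … + F_{n_s} ≡ λ (mod p). -/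
namespace FibSum
open Finset

/-- `F_{2m+d} + F_d = F_m L_{m+d}` for `m = 2 j + 1` odd. -/
lemma cassini (j : ℕ) :
    Nat.fib (2 * j + 2) ^ 2 + 1 = Nat.fib (2 * j + 1) * Nat.fib (2 * j + 3) := by
  induction j with
  | zero => decide
  | succ j ih =>
    have e1 : Nat.fib (2 * j + 3) = Nat.fib (2 * j + 1) + Nat.fib (2 * j + 2) := Nat.fib_add_two
    have e2 : Nat.fib (2 * j + 4) = Nat.fib (2 * j + 2) + Nat.fib (2 * j + 3) := Nat.fib_add_two
    have e3 : Nat.fib (2 * j + 5) = Nat.fib (2 * j + 3) + Nat.fib (2 * j + 4) := Nat.fib_add_two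
    have h4 : 2 * (j + 1) + 2 = 2 * j + 4 := by ring
    have h5 : 2 * (j + 1) + 3 = 2 * j + 5 := by ring
    have h3 : 2 * (j + 1) + 1 = 2 * j + 3 := by ring
    rw [h4, h5, h3, e3, e2]
    rw [e1] at ih ⊢
    nlinarith

lemma fib_prod (j d : ℕ) :
    Nat.fib (4 * j + 2 + d) + Nat.fib d =
      Nat.fib (2 * j + 1) * (Nat.fib (2 * j + d) + Nat.fib (2 * j + d + 2)) := by
  induction d using Nat.twoStepInduction with
  | zero =>
    have h := Nat.fib_add (2 * j + 1) (2 * j)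
    have e : 2 * j + 1 + 2 * j + 1 = 4 * j + 2 + 0 := by ring
    rw [e] at h
    rw [h]
    simp only [Nat.fib_zero, Nat.add_zero]
    ring
  | one =>
    have h := Nat.fib_add (2 * j + 1) (2 * j + 1)
    have e : 2 * j + 1 + (2 * j + 1) + 1 = 4 * j + 2 + 1 := by ring
    rw [e] at h
    rw [h]
    have c := cassini j
    have e2 : 2 * j + 1 + 2 = 2 * j + 3 := by ring
    have e3 : 2 * j + 1 + 1 = 2 * j + 2 := by ring
    rw [e2, e3, Nat.fib_one]
    nlinarith
  | more d h1 h2 =>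
    have a1 : Nat.fib (4 * j + 2 + (d + 2)) = Nat.fib (4 * j + 2 + d) + Nat.fib (4 * j + 2 + (d + 1)) :=
      Nat.fib_add_two
    have a2 : Nat.fib (d + 2) = Nat.fib d + Nat.fib (d + 1) := Nat.fib_add_two
    have a3 : Nat.fib (2 * j + (d + 2)) = Nat.fib (2 * j + d) + Nat.fib (2 * j + (d + 1)) :=
      Nat.fib_add_two
    have a4 : Nat.fib (2 * j + (d + 2) + 2) = Nat.fib (2 * j + d + 2) + Nat.fib (2 * j + (d + 1) + 2) := by
      have : 2 * j + (d + 1) + 2 = 2 * j + d + 2 + 1 := by ring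
      rw [this, ← Nat.fib_add_two]
      congr 1
    have a5 : Nat.succ d = d + 1 := rfl
    simp only [Nat.succ_eq_add_one] at *
    rw [a1, a2, a3, a4]
    linarith

/-- number of primes in a finset dividing a nonzero number below `2 ^ H`. -/
lemma card_prime_dvd (P : Finset ℕ) (hP : ∀ p ∈ P, p.Prime) (v H : ℕ) (hv : v ≠ 0)
    (hH : v ≤ 2 ^ H) : #{p ∈ P | p ∣ v} ≤ H := by
  have h1 : ({p ∈ P | p ∣ v} : Finset ℕ) ⊆ v.primeFactors := by
    intro p hp
    simp only [mem_filter] at hp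
    exact Nat.mem_primeFactors.2 ⟨hP p hp.1, hp.2, hv⟩
  refine (card_le_card h1).trans ?_
  have h2 : 2 ^ #v.primeFactors ≤ ∏ p ∈ v.primeFactors, p :=
    Finset.pow_card_le_prod _ _ _ fun p hp => (Nat.prime_of_mem_primeFactors hp).two_le
  have h3 := Nat.le_of_dvd (Nat.pos_of_ne_zero hv) (Nat.prod_primeFactors_dvd v)
  exact (Nat.pow_le_pow_iff_right (by norm_num)).1 ((h2.trans h3).trans hH)

/-- Double counting of prime divisors. -/
lemma sum_prime_dvd {ι : Type*} (P : Finset ℕ) (hP : ∀ p ∈ P, p.Prime) (T : Finset ι)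
    (v : ι → ℕ) (H : ℕ) (hv : ∀ t ∈ T, v t ≠ 0) (hH : ∀ t ∈ T, v t ≤ 2 ^ H) :
    ∑ p ∈ P, #{t ∈ T | p ∣ v t} ≤ #T * H := by
  have : ∑ p ∈ P, #{t ∈ T | p ∣ v t} = ∑ t ∈ T, #{p ∈ P | p ∣ v t} :=
    Finset.sum_card_bipartiteAbove_eq_sum_card_bipartiteBelow (fun p t => p ∣ v t)
  rw [this]
  exact (Finset.sum_le_card_nsmul _ _ _ fun t ht => card_prime_dvd P hP _ H (hv t ht) (hH t ht))

/-- Cauchy-Schwarz: image size versus collisions. -/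
lemma image_card {ι α : Type*} [DecidableEq α] [DecidableEq ι] (U : Finset ι) (g : ι → α) :
    #U ^ 2 ≤ #(U.image g) * (#U + #{x ∈ U ×ˢ U | x.1 ≠ x.2 ∧ g x.1 = g x.2}) := by
  have h1 : #U = ∑ a ∈ U.image g, #{x ∈ U | g x = a} :=
    Finset.card_eq_sum_card_fiberwise fun x hx => mem_image_of_mem g hx
  have h2 : ∑ a ∈ U.image g, #{x ∈ U | g x = a} ^ 2 =
      #{x ∈ U ×ˢ U | g x.1 = g x.2} := by
    have : #{x ∈ U ×ˢ U | g x.1 = g x.2} =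
        ∑ a ∈ U.image g, #{y ∈ {x ∈ U ×ˢ U | g x.1 = g x.2} | g y.1 = a} :=
      Finset.card_eq_sum_card_fiberwise fun x hx => by
        simp at hx
        exact mem_image_of_mem g hx.1.1
    rw [this]
    refine sum_congr rfl fun a _ => ?_
    rw [sq, ← card_product]
    congr 1
    ext ⟨x, y⟩
    simp only [mem_product, mem_filter]
    constructor
    · rintro ⟨⟨a1, a2⟩, a3, a4⟩
      exact ⟨⟨⟨a1, a3⟩, a2.trans a4.symm⟩, a2⟩
    · rintro ⟨⟨⟨a1, a3⟩, a2⟩, a4⟩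
      exact ⟨⟨a1, a4⟩, a3, a2 ▸ a4⟩
  have h3 : #{x ∈ U ×ˢ U | g x.1 = g x.2} ≤
      #U + #{x ∈ U ×ˢ U | x.1 ≠ x.2 ∧ g x.1 = g x.2} := by
    have : ({x ∈ U ×ˢ U | g x.1 = g x.2} : Finset (ι × ι)) ⊆
        U.image (fun u => (u, u)) ∪ {x ∈ U ×ˢ U | x.1 ≠ x.2 ∧ g x.1 = g x.2} := by
      rintro ⟨x, y⟩ h
      simp only [mem_filter, mem_product, mem_union, mem_image, Prod.mk.injEq] at h ⊢
      by_cases e : x = y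
      · left; exact ⟨x, h.1.1, rfl, e⟩
      · right; exact ⟨h.1, e, h.2⟩
    refine (card_le_card this).trans ((card_union_le _ _).trans ?_)
    gcongr
    exact card_image_le
  calc #U ^ 2 = (∑ a ∈ U.image g, #{x ∈ U | g x = a}) ^ 2 := by rw [← h1]
    _ ≤ #(U.image g) * ∑ a ∈ U.image g, #{x ∈ U | g x = a} ^ 2 := sq_sum_le_card_mul_sum_sq
    _ ≤ _ := by rw [h2]; gcongr

/-- Incidence lemma. -/
lemma incidence (p : ℕ) [Fact p.Prime] (A B C D : Finset (ZMod p))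
    (h : p ^ 3 < #A * #B * #C * #D) :
    ∃ a ∈ A, ∃ b ∈ B, ∃ c ∈ C, a * b + c ∈ D := by
  classical
  by_contra hcon
  push Not at hcon
  let ind : ZMod p → ℕ := fun x => if x ∈ D then 1 else 0
  let f : ZMod p × ZMod p → ℕ := fun z => ∑ b ∈ B, ind (z.1 * b + z.2)
  have hind : ∑ x, ind x = #D := by simp [ind]
  have hindsq : ∀ x, ind x * ind x = ind x := by intro x; simp only [ind]; split_ifs <;> rfl
  have hcard : Fintype.card (ZMod p) = p := ZMod.card p
  -- first moment for one slope
  have hone : ∀ b, ∑ z : ZMod p × ZMod p, ind (z.1 * b + z.2) = p * #D := by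
    intro b
    rw [Fintype.sum_prod_type]
    have : ∀ x : ZMod p, ∑ y : ZMod p, ind (x * b + y) = #D := fun x => by
      rw [← hind]
      exact Equiv.sum_comp (Equiv.addLeft (x * b)) ind
    simp [this, hcard]
  have htwo : ∀ b b', b ≠ b' →
      ∑ z : ZMod p × ZMod p, ind (z.1 * b + z.2) * ind (z.1 * b' + z.2) = #D ^ 2 := by
    intro b b' hb
    have hb' : b - b' ≠ 0 := sub_ne_zero.2 hb
    let e : ZMod p × ZMod p ≃ ZMod p × ZMod p :=
      { toFun := fun z => (z.1 * b + z.2, z.1 * b' + z.2)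
        invFun := fun w => ((w.1 - w.2) / (b - b'), w.1 - (w.1 - w.2) / (b - b') * b)
        left_inv := by
          rintro ⟨x, y⟩
          have : (x * b + y - (x * b' + y)) / (b - b') = x := by
            field_simp; ring
          simp only [this]
          simp
        right_inv := by
          rintro ⟨x, y⟩
          ext
          · simp
          · simp; field_simp; ring }
    have := e.sum_comp (fun w => ind w.1 * ind w.2)
    simp only [e, Equiv.coe_fn_mk] at this
    rw [this, Fintype.sum_prod_type, ← Finset.sum_mul_sum, hind, sq]
  have hS1 : ∑ z, f z = p * #B * #D := by
    simp only [f]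
    rw [sum_comm]
    simp only [hone]
    simp; ring
  have hS2 : ∑ z, f z ^ 2 ≤ p * #B * #D + #B ^ 2 * #D ^ 2 := by
    have : ∑ z, f z ^ 2 = ∑ b ∈ B, ∑ b' ∈ B,
        ∑ z : ZMod p × ZMod p, ind (z.1 * b + z.2) * ind (z.1 * b' + z.2) := by
      simp only [f, sq, Finset.sum_mul_sum]
      rw [sum_comm]
      refine sum_congr rfl fun b _ => ?_
      rw [sum_comm]
    rw [this]
    have hb : ∀ b ∈ B, ∑ b' ∈ B,
        ∑ z : ZMod p × ZMod p, ind (z.1 * b + z.2) * ind (z.1 * b' + z.2)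
        ≤ p * #D + #B * #D ^ 2 := by
      intro b hb
      rw [← Finset.add_sum_erase _ _ hb]
      simp only [hindsq, hone]
      gcongr
      calc _ = ∑ b' ∈ B.erase b, #D ^ 2 := sum_congr rfl fun b' h' =>
              htwo b b' (ne_of_mem_erase h').symm
        _ ≤ _ := by
          rw [sum_const, smul_eq_mul]
          gcongr
          exact erase_subset _ _
    refine (sum_le_card_nsmul _ _ _ hb).trans (le_of_eq ?_)
    simp; ring
  have hzero : ∀ z ∈ A ×ˢ C, f z = 0 := by
    rintro ⟨a, c⟩ hz
    simp only [mem_product] at hz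
    refine sum_eq_zero fun b hb => ?_
    simp [ind, hcon a hz.1 b hb c hz.2]
  have hcs : (∑ z, f z) ^ 2 ≤ #((A ×ˢ C)ᶜ) * ∑ z, f z ^ 2 := by
    have h1 : ∑ z, f z = ∑ z ∈ (A ×ˢ C)ᶜ, f z := by
      rw [← sum_add_sum_compl (A ×ˢ C) f, sum_eq_zero hzero, zero_add]
    rw [h1]
    have h2 : (∑ z ∈ (A ×ˢ C)ᶜ, f z) ^ 2 ≤ #((A ×ˢ C)ᶜ) * ∑ z ∈ (A ×ˢ C)ᶜ, f z ^ 2 := by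
      simpa using sq_sum_le_card_mul_sum_sq (s := (A ×ˢ C)ᶜ) (f := f)
    refine h2.trans (Nat.mul_le_mul_left _ ?_)
    exact sum_le_sum_of_subset (subset_univ _)
  have hcc : #((A ×ˢ C)ᶜ) + #A * #C = p ^ 2 := by
    have := card_compl_add_card (A ×ˢ C)
    rw [card_product] at this
    rw [this]; simp [hcard, sq]
  rw [hS1] at hcs
  have hcs2 := hcs.trans (Nat.mul_le_mul_left _ hS2)
  set X := #((A ×ˢ C)ᶜ)
  have hpos : 0 < #B * #D := by
    rcases Nat.eq_zero_or_pos (#B * #D) with h0 | h0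
    · have : #A * #B * #C * #D = #A * #C * (#B * #D) := by ring
      rw [this, h0] at h; simp at h
    · exact h0
  have h4 : p ^ 2 * (#B * #D) ≤ X * (p + #B * #D) := by
    have : (#B * #D) * (p ^ 2 * (#B * #D)) ≤ (#B * #D) * (X * (p + #B * #D)) := by
      calc _ = (p * #B * #D) ^ 2 := by ring
        _ ≤ _ := hcs2
        _ = _ := by ring
    exact Nat.le_of_mul_le_mul_left this hpos
  have h5 : p ^ 2 * (#B * #D) + #A * #C * (p + #B * #D) ≤ p ^ 2 * (p + #B * #D) := by
    calc _ ≤ X * (p + #B * #D) + #A * #C * (p + #B * #D) := by gcongr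
      _ = (X + #A * #C) * (p + #B * #D) := by ring
      _ = _ := by rw [hcc]
  have h6 : #A * #B * #C * #D = #A * #C * (#B * #D) := by ring
  rw [h6] at h
  nlinarith [Nat.zero_le (#A * #C * p)]

/-- `x` is a sum of `s` Fibonacci numbers with positive indices at most `I`. -/
def Rep (p s I : ℕ) (x : ZMod p) : Prop :=
  ∃ n : Fin s → ℕ, (∀ i, 1 ≤ n i ∧ n i ≤ I) ∧ ∑ i, (Nat.fib (n i) : ZMod p) = x

lemma Rep.add {p s t I : ℕ} {x y : ZMod p} (hx : Rep p s I x) (hy : Rep p t I y) :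
    Rep p (s + t) I (x + y) := by
  obtain ⟨n, hn, rfl⟩ := hx
  obtain ⟨m, hm, rfl⟩ := hy
  refine ⟨Fin.append n m, fun i => ?_, ?_⟩
  · refine Fin.addCases (fun i => ?_) (fun i => ?_) i
    · simpa using hn i
    · simpa using hm i
  · simp [Fin.sum_univ_add]

/-- index attached to the `i`-th block -/
def blk (M i j : ℕ) : ℕ := i * M + j + 1

/-- the sum of Fibonacci numbers of odd index, one in each block -/
def S (M k : ℕ) (f : Fin k → Fin M) : ℕ := ∑ i : Fin k, Nat.fib (2 * blk M i (f i) + 1)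

lemma blk_le {M i j k : ℕ} (hi : i < k) (hj : j < M) : blk M i j ≤ k * M := by
  unfold blk
  have : (i + 1) * M ≤ k * M := Nat.mul_le_mul_right _ hi
  nlinarith

lemma S_succ (M k : ℕ) (f : Fin (k + 1) → Fin M) :
    S M (k + 1) f = S M k (fun i => f i.castSucc) + Nat.fib (2 * blk M k (f (Fin.last k)) + 1) := by
  simp [S, Fin.sum_univ_castSucc]

lemma S_lt (M k : ℕ) (f : Fin k → Fin M) : S M k f < Nat.fib (2 * (k * M) + 2) := by
  induction k with
  | zero => simp [S]
  | succ k ih =>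
    rw [S_succ]
    have h1 := ih (fun i => f i.castSucc)
    have h2 : Nat.fib (2 * (k * M) + 2) ≤ Nat.fib (2 * blk M k (f (Fin.last k))) :=
      Nat.fib_mono (by unfold blk; omega)
    have h3 : Nat.fib (2 * blk M k (f (Fin.last k)) + 2) ≤ Nat.fib (2 * ((k + 1) * M) + 2) :=
      Nat.fib_mono (by have := blk_le (k := k + 1) (Nat.lt_succ_self k) (f (Fin.last k)).2; omega)
    rw [Nat.fib_add_two] at h3
    omega

lemma S_inj (M k : ℕ) : Function.Injective (S M k) := by
  induction k with
  | zero => intro f g _; exact Subsingleton.elim _ _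
  | succ k ih =>
    have key : ∀ f g : Fin (k + 1) → Fin M, S M (k + 1) f = S M (k + 1) g →
        (f (Fin.last k) : ℕ) ≤ g (Fin.last k) := by
      intro f g h
      by_contra hlt
      push Not at hlt
      rw [S_succ, S_succ] at h
      have h1 := S_lt M k (fun i => g i.castSucc)
      have h2 : Nat.fib (2 * (k * M) + 2) ≤ Nat.fib (2 * blk M k (g (Fin.last k))) :=
        Nat.fib_mono (by unfold blk; omega)
      have h3 : Nat.fib (2 * blk M k (g (Fin.last k)) + 2) ≤
          Nat.fib (2 * blk M k (f (Fin.last k)) + 1) :=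
        Nat.fib_mono (by unfold blk; omega)
      rw [Nat.fib_add_two] at h3
      omega
    intro f g h
    have hlast : f (Fin.last k) = g (Fin.last k) :=
      Fin.ext (le_antisymm (key f g h) (key g f h.symm))
    have hrest : (fun i : Fin k => f i.castSucc) = fun i => g i.castSucc := by
      apply ih
      rw [S_succ, S_succ, hlast] at h
      omega
    funext i
    refine Fin.lastCases hlast (fun i => congrFun hrest i) i

lemma fib_le_two_pow (n : ℕ) : Nat.fib n ≤ 2 ^ n := by
  induction n using Nat.twoStepInduction with
  | zero => simp
  | one => simp
  | more n h1 h2 =>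
    rw [Nat.fib_add_two]
    simp only [pow_succ] at *
    omega

/-- shifted Lucas numbers -/
def bb (K t : ℕ) : ℕ := Nat.fib (K + t) + Nat.fib (K + t + 2)

lemma bb_strictMono (K : ℕ) : StrictMono (bb K) := by
  refine strictMono_nat_of_lt_succ fun t => ?_
  unfold bb
  have h1 : Nat.fib (K + t) ≤ Nat.fib (K + (t + 1)) := Nat.fib_mono (by omega)
  have h2 : Nat.fib (K + t + 2) < Nat.fib (K + (t + 1) + 2) :=
    (Nat.fib_lt_fib (by omega)).2 (by omega)
  omega

lemma rep_S (p M k I : ℕ) (hI : 2 * (k * M) + 1 ≤ I) (f : Fin k → Fin M) :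
    Rep p k I (S M k f : ZMod p) := by
  refine ⟨fun i => 2 * blk M i (f i) + 1, fun i => ?_, by simp [S]⟩
  have := blk_le i.2 (f i).2
  dsimp only
  omega

lemma rep_mul (p M k K I t : ℕ) (hK : 2 * (k * M) < K) (ht : t < K) (hI : 4 * K ≤ I)
    (f : Fin k → Fin M) : Rep p (k + k) I ((S M k f : ZMod p) * (bb K t : ZMod p)) := by
  have hb : ∀ i : Fin k, blk M i (f i) ≤ k * M := fun i => blk_le i.2 (f i).2
  have e : (S M k f : ZMod p) * (bb K t : ZMod p) =
      ∑ i : Fin k, (Nat.fib (4 * blk M i (f i) + 2 + (K + t - 2 * blk M i (f i))) : ZMod p) +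
      ∑ i : Fin k, (Nat.fib (K + t - 2 * blk M i (f i)) : ZMod p) := by
    rw [← sum_add_distrib, S, Nat.cast_sum, sum_mul]
    refine sum_congr rfl fun i _ => ?_
    have h := fib_prod (blk M i (f i)) (K + t - 2 * blk M i (f i))
    have e1 : 2 * blk M i (f i) + (K + t - 2 * blk M i (f i)) = K + t := by
      have := hb i; omega
    rw [e1] at h
    rw [← Nat.cast_add, h, Nat.cast_mul, bb]
  rw [e]
  refine Rep.add ⟨_, fun i => ?_, rfl⟩ ⟨_, fun i => ?_, rfl⟩
  · have := hb i; omega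
  · have := hb i; omega


lemma cast_eq_iff (p a b : ℕ) : ((a : ZMod p) = (b : ZMod p)) ↔ p ∣ ((a : ℤ) - b).natAbs := by
  rw [← Int.natCast_dvd, ← ZMod.intCast_zmod_eq_zero_iff_dvd]
  push_cast
  exact sub_eq_zero.symm

lemma good_prime (p k M N P : ℕ) [Fact p.Prime] (hpN : p ≤ N) (hM : 8 < M)
    (hkM : 2 * (k * M) < M ^ 10) (hNk : N ≤ M ^ k) (hNP : N ≤ P * M) (hPN : P ≤ N)
    (hcoll : P * #{x ∈ (univ : Finset (Fin k → Fin M)) ×ˢ (univ : Finset (Fin k → Fin M)) |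
      x.1 ≠ x.2 ∧ (S M k x.1 : ZMod p) = S M k x.2} ≤ M ^ (2 * k + 2))
    (hinj : ∀ t < M ^ 10, ∀ t' < M ^ 10,
      (bb (M ^ 10) t : ZMod p) = bb (M ^ 10) t' → t = t') (x : ZMod p) :
    Rep p ((k + k) + (k + k)) (4 * M ^ 10) x := by
  classical
  set A : Finset (ZMod p) := univ.image fun f : Fin k → Fin M => (S M k f : ZMod p) with hA
  set B : Finset (ZMod p) := (range (M ^ 10)).image fun t => (bb (M ^ 10) t : ZMod p) with hB
  set D : Finset (ZMod p) := A.image fun a => x - a with hD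
  have hBc : #B = M ^ 10 := by
    rw [hB, card_image_of_injOn, card_range]
    intro t ht t' ht' h
    simp only [coe_range, Set.mem_Iio] at ht ht'
    exact hinj t ht t' ht' h
  have hDc : #D = #A := card_image_of_injective _ sub_right_injective
  have h1 := image_card (univ : Finset (Fin k → Fin M)) (fun f => (S M k f : ZMod p))
  have hU : #(univ : Finset (Fin k → Fin M)) = M ^ k := by simp
  rw [hU, ← hA] at h1
  set n := #{x ∈ (univ : Finset (Fin k → Fin M)) ×ˢ (univ : Finset (Fin k → Fin M)) |
      x.1 ≠ x.2 ∧ (S M k x.1 : ZMod p) = S M k x.2} with hn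
  have hMpos : 0 < M := by omega
  have h2 : P * (M ^ k) ^ 2 ≤ (#A * (2 * M ^ 2)) * (M ^ k) ^ 2 := by
    calc P * (M ^ k) ^ 2 ≤ P * (#A * (M ^ k + n)) := Nat.mul_le_mul_left _ h1
      _ = #A * (P * M ^ k + P * n) := by ring
      _ ≤ #A * (M ^ k * M ^ k + M ^ (2 * k + 2)) := by
          gcongr
          exact hPN.trans hNk
      _ ≤ #A * (M ^ (2 * k + 2) + M ^ (2 * k + 2)) := by
          gcongr
          rw [← pow_add]
          exact Nat.pow_le_pow_right hMpos (by omega)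
      _ = _ := by ring
  have h3 : P ≤ #A * (2 * M ^ 2) := Nat.le_of_mul_le_mul_right h2 (by positivity)
  have h4 : p ≤ #A * (2 * M ^ 3) := by
    calc p ≤ P * M := hpN.trans hNP
      _ ≤ #A * (2 * M ^ 2) * M := Nat.mul_le_mul_right _ h3
      _ = _ := by ring
  have hp0 : 0 < p := (Fact.out : p.Prime).pos
  have hA0 : 0 < #A := by
    rcases Nat.eq_zero_or_pos #A with h0 | h0
    · rw [h0] at h4; omega
    · exact h0
  have h5 : p ^ 3 < #A * #B * #A * #D := by
    rw [hBc, hDc]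
    calc p ^ 3 ≤ (#A * (2 * M ^ 3)) ^ 3 := Nat.pow_le_pow_left h4 3
      _ = #A ^ 3 * M ^ 9 * 8 := by ring
      _ < #A ^ 3 * M ^ 9 * M := Nat.mul_lt_mul_of_pos_left hM (by positivity)
      _ = _ := by ring
  obtain ⟨a, ha, b, hb, c, hc, hd⟩ := incidence p A B A D h5
  simp only [hA, hB, hD, mem_image, mem_univ, true_and, mem_range] at ha hb hc hd
  obtain ⟨f, rfl⟩ := ha
  obtain ⟨t, ht, rfl⟩ := hb
  obtain ⟨g, rfl⟩ := hc
  obtain ⟨_, ⟨h, rfl⟩, he⟩ := hd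
  have hx : x = (S M k f : ZMod p) * (bb (M ^ 10) t : ZMod p) +
      ((S M k g : ZMod p) + (S M k h : ZMod p)) := by
    rw [← add_assoc, ← he]; ring
  rw [hx]
  exact (rep_mul p M k (M ^ 10) _ t hkM ht le_rfl f).add
    ((rep_S p M k _ (by omega) g).add (rep_S p M k _ (by omega) h))

lemma natAbs_sub_le {a b H : ℕ} (ha : a ≤ 2 ^ H) (hb : b ≤ 2 ^ H) :
    ((a : ℤ) - b).natAbs ≤ 2 ^ H := by omega

lemma natAbs_sub_ne {a b : ℕ} (h : a ≠ b) : ((a : ℤ) - b).natAbs ≠ 0 := by omega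

open Classical in
lemma bad_count (k M N : ℕ) (hM : 8 < M) (hkM : 2 * (k * M) < M ^ 10) (hNk : N ≤ M ^ k)
    (hNP : N ≤ N.primeCounting * M) (hMN : M ^ 40 ≤ N) :
    #{p ∈ Nat.primesLE N | ¬ ∀ x : ZMod p, Rep p ((k + k) + (k + k)) (4 * M ^ 10) x} * M
      ≤ N.primeCounting * (2 * k + 6) := by
  set P := N.primeCounting with hP
  set L := Nat.primesLE N with hL
  have hLc : #L = P := Nat.primesLE_card_eq_primeCounting N
  have hLp : ∀ p ∈ L, p.Prime := fun p hp => (Nat.mem_primesLE.1 hp).2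
  have hLN : ∀ p ∈ L, p ≤ N := fun p hp => (Nat.mem_primesLE.1 hp).1
  have hPN : P ≤ N := by
    rw [← hLc]
    calc #L ≤ #(Icc 1 N) := card_le_card fun p hp =>
            mem_Icc.2 ⟨(hLp p hp).pos, hLN p hp⟩
      _ = N := by simp
  have hMpos : 0 < M := by omega
  set T1 := {x ∈ (univ : Finset (Fin k → Fin M)) ×ˢ (univ : Finset (Fin k → Fin M)) |
      x.1 ≠ x.2} with hT1
  set v1 : (Fin k → Fin M) × (Fin k → Fin M) → ℕ :=
    fun x => ((S M k x.1 : ℤ) - S M k x.2).natAbs with hv1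
  set T2 := {x ∈ range (M ^ 10) ×ˢ range (M ^ 10) | x.1 ≠ x.2} with hT2
  set v2 : ℕ × ℕ → ℕ := fun x => ((bb (M ^ 10) x.1 : ℤ) - bb (M ^ 10) x.2).natAbs with hv2
  have c1 : #T1 ≤ M ^ (2 * k) := by
    refine (card_filter_le _ _).trans (le_of_eq ?_)
    simp [card_product]; ring
  have c2 : #T2 ≤ M ^ 20 := by
    refine (card_filter_le _ _).trans (le_of_eq ?_)
    simp [card_product]; ring
  have s1 : ∑ p ∈ L, #{t ∈ T1 | p ∣ v1 t} ≤ #T1 * (2 * (k * M) + 2) := by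
    refine sum_prime_dvd L hLp T1 v1 _ ?_ ?_
    · intro t ht
      simp only [hT1, mem_filter] at ht
      exact natAbs_sub_ne fun h => ht.2 (S_inj M k h)
    · intro t _
      exact natAbs_sub_le ((S_lt M k _).le.trans (fib_le_two_pow _))
        ((S_lt M k _).le.trans (fib_le_two_pow _))
  have hbb : ∀ t < M ^ 10, bb (M ^ 10) t ≤ 2 ^ (2 * M ^ 10 + 2) := by
    intro t ht
    unfold bb
    have h1 := fib_le_two_pow (M ^ 10 + t)
    have h2 := fib_le_two_pow (M ^ 10 + t + 2)
    have h3 : 2 ^ (M ^ 10 + t + 3) ≤ 2 ^ (2 * M ^ 10 + 2) :=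
      Nat.pow_le_pow_right (by norm_num) (by omega)
    simp only [pow_succ 2] at h2 h3 ⊢
    omega
  have s2 : ∑ p ∈ L, #{t ∈ T2 | p ∣ v2 t} ≤ #T2 * (2 * M ^ 10 + 2) := by
    refine sum_prime_dvd L hLp T2 v2 _ ?_ ?_
    · intro t ht
      simp only [hT2, mem_filter] at ht
      exact natAbs_sub_ne fun h => ht.2 ((bb_strictMono _).injective h)
    · intro t ht
      simp only [hT2, mem_filter, mem_product, mem_range] at ht
      exact natAbs_sub_le (hbb _ ht.1.1) (hbb _ ht.1.2)
  set P1 := {p ∈ L | M ^ (2 * k + 2) < P * #{t ∈ T1 | p ∣ v1 t}} with hP1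
  set P2 := {p ∈ L | 1 ≤ #{t ∈ T2 | p ∣ v2 t}} with hP2
  have hsub : ({p ∈ L | ¬ ∀ x : ZMod p, Rep p ((k + k) + (k + k)) (4 * M ^ 10) x} : Finset ℕ)
      ⊆ P1 ∪ P2 := by
    intro p hp
    rw [mem_filter] at hp
    by_contra hcon
    rw [mem_union, not_or] at hcon
    simp only [hP1, hP2, mem_filter, hp.1, true_and, not_lt, not_le] at hcon
    apply hp.2
    have : Fact p.Prime := ⟨hLp p hp.1⟩
    refine good_prime p k M N P (hLN p hp.1) hM hkM hNk hNP hPN ?_ ?_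
    · refine le_trans (le_of_eq ?_) hcon.1
      congr 2
      ext t
      simp only [hT1, hv1, mem_filter, cast_eq_iff, and_assoc]
    · intro t ht t' ht' h
      by_contra hne
      have h0 : #{t ∈ T2 | p ∣ v2 t} = 0 := by omega
      rw [card_eq_zero] at h0
      have : (t, t') ∈ ({t ∈ T2 | p ∣ v2 t} : Finset (ℕ × ℕ)) := by
        simp only [hT2, hv2, mem_filter, mem_product, mem_range]
        exact ⟨⟨⟨ht, ht'⟩, hne⟩, (cast_eq_iff _ _ _).1 h⟩
      rw [h0] at this
      simp at this
  have b1 : #P1 * M ≤ P * (2 * k + 2) := by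
    have h1 : #P1 * M ^ (2 * k + 2) ≤ P * (M ^ (2 * k) * (2 * (k * M) + 2)) := by
      calc #P1 * M ^ (2 * k + 2) ≤ ∑ p ∈ P1, P * #{t ∈ T1 | p ∣ v1 t} := by
            rw [← smul_eq_mul]
            refine card_nsmul_le_sum _ _ _ fun p hp => ?_
            rw [hP1, mem_filter] at hp
            exact hp.2.le
        _ ≤ ∑ p ∈ L, P * #{t ∈ T1 | p ∣ v1 t} :=
            sum_le_sum_of_subset (filter_subset _ _)
        _ = P * ∑ p ∈ L, #{t ∈ T1 | p ∣ v1 t} := by rw [mul_sum]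
        _ ≤ P * (#T1 * (2 * (k * M) + 2)) := Nat.mul_le_mul_left _ s1
        _ ≤ _ := by gcongr
    have h2 : (#P1 * M) * M ^ (2 * k + 1) ≤ (P * (2 * k + 2)) * M ^ (2 * k + 1) := by
      calc (#P1 * M) * M ^ (2 * k + 1) = #P1 * M ^ (2 * k + 2) := by ring
        _ ≤ P * (M ^ (2 * k) * (2 * (k * M) + 2)) := h1
        _ ≤ P * (M ^ (2 * k) * (2 * (k * M) + 2 * M)) := by gcongr; omega
        _ = _ := by ring
    exact Nat.le_of_mul_le_mul_right h2 (by positivity)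
  have b2 : #P2 * M ≤ P * 4 := by
    have h1 : #P2 ≤ M ^ 20 * (2 * M ^ 10 + 2) := by
      calc #P2 = #P2 • 1 := by simp
        _ ≤ ∑ p ∈ P2, #{t ∈ T2 | p ∣ v2 t} := by
            refine card_nsmul_le_sum _ _ _ fun p hp => ?_
            rw [hP2, mem_filter] at hp
            exact hp.2
        _ ≤ ∑ p ∈ L, #{t ∈ T2 | p ∣ v2 t} := sum_le_sum_of_subset (filter_subset _ _)
        _ ≤ _ := s2
        _ ≤ _ := by gcongr
    have h2 : (#P2 * M) * M ≤ (P * 4) * M := by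
      have hM10 : 1 ≤ M ^ 10 := Nat.one_le_pow _ _ hMpos
      calc (#P2 * M) * M ≤ (M ^ 20 * (2 * M ^ 10 + 2)) * M * M := by gcongr
        _ ≤ (M ^ 20 * (2 * M ^ 10 + 2 * M ^ 10)) * M * M := by gcongr; omega
        _ = 4 * M ^ 32 := by ring
        _ ≤ 4 * M ^ 40 := by gcongr <;> omega
        _ ≤ 4 * (P * M) := by gcongr; exact hMN.trans hNP
        _ = _ := by ring
    exact Nat.le_of_mul_le_mul_right h2 hMpos
  calc _ ≤ (#P1 + #P2) * M := by
        gcongr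
        exact (card_le_card hsub).trans (card_union_le _ _)
    _ = #P1 * M + #P2 * M := by ring
    _ ≤ P * (2 * k + 2) + P * 4 := by gcongr
    _ = _ := by ring

open Filter Topology in
lemma asymp (ε : ℝ) (hε0 : 0 < ε) (hε : ε < 1 / 2) (k : ℕ) (hk : 20 / ε + 1 ≤ k) (R : ℝ) :
    ∀ᶠ N : ℕ in atTop, ∃ M : ℕ, R ≤ M ∧ ((M : ℝ) ^ 20 ≤ (N : ℝ) ^ ε) ∧ M ^ 40 ≤ N ∧
      N ≤ M ^ k ∧ N ≤ N.primeCounting * M := by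
  have hη : 0 < ε / 20 := by positivity
  have hcast : Tendsto (fun N : ℕ => (N : ℝ)) atTop atTop := tendsto_natCast_atTop_atTop
  have hy : Tendsto (fun N : ℕ => (N : ℝ) ^ (ε / 20)) atTop atTop :=
    (tendsto_rpow_atTop hη).comp hcast
  have hlog : ∀ᶠ N : ℕ in atTop, Real.log N ≤ 1 / 8 * (N : ℝ) ^ (ε / 20) := by
    have h := (isLittleO_log_rpow_atTop hη).bound (show (0 : ℝ) < 1 / 8 by norm_num)
    filter_upwards [hcast.eventually h] with N hN
    have h2 : ‖(N : ℝ) ^ (ε / 20)‖ = (N : ℝ) ^ (ε / 20) :=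
      Real.norm_of_nonneg (Real.rpow_nonneg (Nat.cast_nonneg N) _)
    rw [h2] at hN
    exact (Real.le_norm_self _).trans hN
  have hlog1 : ∀ᶠ N : ℕ in atTop, Real.log (N + 1) ≤ 1 / 8 * ((N : ℝ) + 1) := by
    have h := Real.isLittleO_log_id_atTop.bound (show (0 : ℝ) < 1 / 8 by norm_num)
    have hc1 : Tendsto (fun N : ℕ => (N : ℝ) + 1) atTop atTop :=
      tendsto_atTop_add_const_right _ _ hcast
    filter_upwards [hc1.eventually h] with N hN
    have h2 : ‖id ((N : ℝ) + 1)‖ = (N : ℝ) + 1 := by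
      rw [id, Real.norm_of_nonneg (by positivity)]
    rw [h2] at hN
    exact (Real.le_norm_self _).trans hN
  filter_upwards [hlog, hlog1, hy.eventually_ge_atTop (R + 1), hy.eventually_ge_atTop 2,
    hy.eventually_ge_atTop ((2 : ℝ) ^ k), eventually_ge_atTop 2] with N h1 h2 h3 h4 h5 h6
  have hN1 : (1 : ℝ) ≤ N := by exact_mod_cast (by omega : 1 ≤ N)
  have hN2 : (2 : ℝ) ≤ N := by exact_mod_cast h6
  have hN0 : (0 : ℝ) ≤ N := by linarith
  set y := (N : ℝ) ^ (ε / 20) with hydef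
  have hMle : (⌊y⌋₊ : ℝ) ≤ y := Nat.floor_le (by linarith)
  have hMge : y - 1 < ⌊y⌋₊ := Nat.sub_one_lt_floor y
  have hMhalf : y / 2 ≤ ⌊y⌋₊ := by linarith
  have hM20 : (⌊y⌋₊ : ℝ) ^ 20 ≤ (N : ℝ) ^ ε := by
    calc (⌊y⌋₊ : ℝ) ^ 20 ≤ y ^ 20 := by gcongr
      _ = (N : ℝ) ^ ε := by
        rw [hydef, ← Real.rpow_natCast, ← Real.rpow_mul hN0]
        congr 1
        push_cast
        ring
  refine ⟨⌊y⌋₊, by linarith, hM20, ?_, ?_, ?_⟩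
  · have : (⌊y⌋₊ : ℝ) ^ 40 ≤ N := by
      calc (⌊y⌋₊ : ℝ) ^ 40 = ((⌊y⌋₊ : ℝ) ^ 20) ^ 2 := by ring
        _ ≤ ((N : ℝ) ^ ε) ^ 2 := by gcongr
        _ = (N : ℝ) ^ (ε * 2) := by
          rw [← Real.rpow_natCast, ← Real.rpow_mul hN0]; norm_num
        _ ≤ (N : ℝ) ^ (1 : ℝ) := Real.rpow_le_rpow_of_exponent_le hN1 (by linarith)
        _ = N := Real.rpow_one _
    exact_mod_cast this
  · have hyk : (N : ℝ) * y ≤ y ^ k := by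
      calc (N : ℝ) * y = (N : ℝ) ^ (1 + ε / 20) := by
            rw [Real.rpow_add (by linarith), Real.rpow_one]
        _ ≤ (N : ℝ) ^ (ε / 20 * k) := by
            refine Real.rpow_le_rpow_of_exponent_le hN1 ?_
            calc 1 + ε / 20 = ε / 20 * (20 / ε + 1) := by field_simp
              _ ≤ _ := by gcongr
        _ = y ^ k := by rw [hydef, ← Real.rpow_natCast, ← Real.rpow_mul hN0]
    have : (N : ℝ) ≤ (⌊y⌋₊ : ℝ) ^ k := by
      calc (N : ℝ) ≤ (y / 2) ^ k := by
            rw [div_pow, le_div_iff₀ (by positivity)]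
            refine le_trans ?_ hyk
            gcongr
        _ ≤ _ := by gcongr
    exact_mod_cast this
  · have hpi := Chebyshev.pi_ge N
    have hlogpos : 0 < Real.log N := Real.log_pos (by linarith)
    rw [div_le_iff₀ hlogpos] at hpi
    have hl2 := Real.log_two_gt_d9
    have hlow : (N : ℝ) / 4 ≤ N * Real.log 2 - Real.log (N + 1) := by nlinarith
    have h7 : (N : ℝ) / 4 ≤ N.primeCounting * (1 / 8 * y) := by
      refine (hlow.trans hpi).trans ?_
      gcongr
    have h8 : (N.primeCounting : ℝ) * (y / 2) ≤ N.primeCounting * ⌊y⌋₊ := by gcongr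
    have : (N : ℝ) ≤ N.primeCounting * ⌊y⌋₊ := by linarith
    exact_mod_cast this

end FibSum

/-- **Theorem 4 (sums of `s` Fibonacci numbers with small indices).**
Let `0 < ε < 1/2`. There is a positive integer `s < 100/ε` such that for every
`δ > 0` and all sufficiently large `N`, for all but at most `δ·π(N)` primes
`p ≤ N`: every integer `λ` can be written as `F_{n₁} + … + F_{n_s} ≡ λ (mod p)`
with positive integers `n_i ≤ N^ε`. -/
theorem stmt_7 (ε : ℝ) (hε0 : 0 < ε) (hε : ε < 1 / 2) :
    ∃ s : ℕ, 0 < s ∧ (s : ℝ) < 100 / ε ∧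
      ∀ δ : ℝ, 0 < δ → ∃ N₀ : ℕ, ∀ N : ℕ, N₀ ≤ N →
        ({p : ℕ | p ≤ N ∧ p.Prime ∧
            ¬ (∀ lam : ℤ, ∃ n : Fin s → ℕ,
                (∀ i, 1 ≤ n i ∧ (n i : ℝ) ≤ (N : ℝ) ^ ε) ∧
                (∑ i, (Nat.fib (n i) : ℤ)) ≡ lam [ZMOD p])}.ncard : ℝ)
          ≤ δ * (N.primeCounting : ℝ) := by
  classical
  set k : ℕ := ⌈20 / ε⌉₊ + 1 with hk
  have hε40 : 40 < 20 / ε := by rw [lt_div_iff₀ hε0]; linarith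
  have hk1 : 20 / ε + 1 ≤ (k : ℝ) := by
    rw [hk]; push_cast
    have := Nat.le_ceil (20 / ε)
    linarith
  have hk2 : (k : ℝ) < 20 / ε + 2 := by
    rw [hk]; push_cast
    have := Nat.ceil_lt_add_one (show 0 ≤ 20 / ε by positivity)
    linarith
  refine ⟨(k + k) + (k + k), by omega, ?_, fun δ hδ => ?_⟩
  · push_cast
    have : 100 / ε = 5 * (20 / ε) := by ring
    rw [this]
    linarith
  obtain ⟨N₀, hN₀⟩ := Filter.eventually_atTop.1
    (FibSum.asymp ε hε0 hε k hk1 (2 * k + 9 + (2 * k + 6) / δ))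
  refine ⟨N₀, fun N hN => ?_⟩
  obtain ⟨M, hR, hM20, hM40, hNk, hNP⟩ := hN₀ N hN
  have hq : 0 ≤ (2 * (k : ℝ) + 6) / δ := by positivity
  have hM9 : 2 * k + 9 ≤ M := by
    have : (2 * (k : ℝ) + 9) ≤ M := by linarith
    exact_mod_cast this
  have hMδ : (2 * (k : ℝ) + 6) ≤ M * δ := by
    rw [← div_le_iff₀ hδ]
    have : (0 : ℝ) ≤ k := Nat.cast_nonneg k
    linarith
  have hMpos : 0 < M := by omega
  have hkM : 2 * (k * M) < M ^ 10 := by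
    calc 2 * (k * M) = (2 * k) * M := by ring
      _ < M * M := Nat.mul_lt_mul_of_pos_right (by omega) hMpos
      _ = M ^ 2 := by ring
      _ ≤ M ^ 10 := Nat.pow_le_pow_right hMpos (by norm_num)
  have hI : ((4 * M ^ 10 : ℕ) : ℝ) ≤ (N : ℝ) ^ ε := by
    refine le_trans ?_ hM20
    have : 4 * M ^ 10 ≤ M ^ 20 := by
      calc 4 * M ^ 10 ≤ M * M ^ 10 := Nat.mul_le_mul_right _ (by omega)
        _ = M ^ 11 := by ring
        _ ≤ M ^ 20 := Nat.pow_le_pow_right hMpos (by norm_num)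
    exact_mod_cast this
  have hcount := FibSum.bad_count k M N (by omega) hkM hNk hNP hM40
  set bad : Finset ℕ := {p ∈ Nat.primesLE N |
    ¬ ∀ x : ZMod p, FibSum.Rep p ((k + k) + (k + k)) (4 * M ^ 10) x} with hbad
  have hsub : {p : ℕ | p ≤ N ∧ p.Prime ∧
            ¬ (∀ lam : ℤ, ∃ n : Fin ((k + k) + (k + k)) → ℕ,
                (∀ i, 1 ≤ n i ∧ (n i : ℝ) ≤ (N : ℝ) ^ ε) ∧
                (∑ i, (Nat.fib (n i) : ℤ)) ≡ lam [ZMOD p])} ⊆ (bad : Set ℕ) := by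
    rintro p ⟨hpN, hp, hfail⟩
    rw [Finset.mem_coe, hbad, Finset.mem_filter]
    refine ⟨Nat.mem_primesLE.2 ⟨hpN, hp⟩, fun hall => hfail fun lam => ?_⟩
    obtain ⟨n, hn, hsum⟩ := hall (lam : ZMod p)
    refine ⟨n, fun i => ⟨(hn i).1, ?_⟩, ?_⟩
    · refine le_trans ?_ hI
      exact_mod_cast (hn i).2
    · rw [← ZMod.intCast_eq_intCast_iff]
      push_cast
      exact hsum
  have hcard := Set.ncard_le_ncard hsub bad.finite_toSet
  rw [Set.ncard_coe_finset] at hcard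
  refine (Nat.cast_le.2 hcard).trans ?_
  have hMr : (0 : ℝ) < M := by exact_mod_cast hMpos
  have hc : (bad.card : ℝ) * M ≤ N.primeCounting * (2 * k + 6) := by exact_mod_cast hcount
  refine le_of_mul_le_mul_right ?_ hMr
  calc (bad.card : ℝ) * M ≤ N.primeCounting * (2 * k + 6) := hc
    _ ≤ N.primeCounting * (M * δ) := by gcongr
    _ = δ * N.primeCounting * M := by ring
end
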